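/- There is a universal constant c > 0 such that for every integer k ≥ 2, every ε ∈ (0,1), and every integer m with m < c·min(k^(6/7)/ε^(8/7), k), there exists an integer N such that for every (possibly randomized) test T taking m i.i.d. samples from a distribution p on [N]×[N] and m i.i.d. samples from a distribution q on [N]×[N], there exist discrete probability distributions p, q on [N]×[N] for which T fails: either p = q and T outputs 'reject' with probability greater than 1/3, or ‖p − q‖_{A_k} ≥ Ω(ε) and T outputs 'accept' with probability greater than 1/3. In particular, Ω(min(k^(6/7)/ε^(8/7), k)) samples are necessary for A_k closeness testing of two-dimensional discrete distributions on a sufficiently large domain. -/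

import Mathlib

open MeasureTheory

/-- An axis-aligned rectangle in `ℝ^d` is a product of `d` intervals. -/
def IsAxisAlignedRectangle {d : ℕ} (R : Set (Fin d → ℝ)) : Prop :=
  ∃ I : Fin d → Set ℝ, (∀ i, (I i).OrdConnected) ∧ R = Set.univ.pi I

/-- The `A_k` distance between two measures on `ℝ^d`. -/
noncomputable def AkDist {d : ℕ} (k : ℕ) (p q : Measure (Fin d → ℝ)) : ℝ :=
  ⨆ R : {R : Fin k → Set (Fin d → ℝ) //
      (∀ i, IsAxisAlignedRectangle (R i)) ∧
      Pairwise fun i j => Disjoint (R i) (R j)},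
    ∑ i, |(p (R.1 i)).toReal - (q (R.1 i)).toReal|

/-- A measure on `ℝ²` is supported on the grid `[N] × [N]` (viewed as the points
`{1, …, N}²` in `ℝ²`). -/
def GridSupported (N : ℕ) (p : Measure (Fin 2 → ℝ)) : Prop :=
  p {x | ∀ i, ∃ j : Fin N, x i = (j : ℝ) + 1}ᶜ = 0

theorem exists_homogeneous_finset (n : ℕ) : ∀ (κ : Type) [Finite κ] (M : ℕ), ∃ N : ℕ,
    ∀ A : Finset ℕ, N ≤ A.card → ∀ c : Finset ℕ → κ,
      ∃ H ⊆ A, H.card = M ∧ ∃ x, ∀ S ⊆ H, S.card = n → c S = x := by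
  induction n with
  | zero =>
    intro κ _ M
    refine ⟨M, fun A hA c => ?_⟩
    obtain ⟨H, hH, hc⟩ := Finset.exists_subset_card_eq hA
    refine ⟨H, hH, hc, c ∅, fun S _ hS => ?_⟩
    rw [Finset.card_eq_zero.1 hS]
  | succ n ih =>
    intro κ _ M
    have key : ∀ t : ℕ, ∃ N : ℕ, ∀ A : Finset ℕ, N ≤ A.card → ∀ c : Finset ℕ → κ,
        ∃ H ⊆ A, H.card = t ∧ ∃ f : ℕ → κ, ∀ a, ∀ S : Finset ℕ, S.card = n → (∀ b ∈ S, a < b) →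
          insert a S ⊆ H → c (insert a S) = f a := by
      intro t
      induction t with
      | zero =>
        refine ⟨0, fun A _ c => ⟨∅, by simp, rfl, fun _ => c ∅, fun a S _ _ h => ?_⟩⟩
        exact absurd (h (Finset.mem_insert_self a S)) (by simp)
      | succ t iht =>
        obtain ⟨N₁, hN₁⟩ := iht
        obtain ⟨N₂, hN₂⟩ := ih κ N₁
        refine ⟨N₂ + 1, fun A hA c => ?_⟩
        have hne : A.Nonempty := Finset.card_pos.1 (by omega)
        set a := A.min' hne with ha
        have hcard : N₂ ≤ (A.erase a).card := by
          rw [Finset.card_erase_of_mem (A.min'_mem hne)]; omega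
        obtain ⟨H₂, hH₂, hc₂, x, hx⟩ := hN₂ _ hcard fun S => c (insert a S)
        obtain ⟨H₁, hH₁, hc₁, f, hf⟩ := hN₁ H₂ hc₂.ge c
        have hlt : ∀ b ∈ H₁, a < b := fun b hb => by
          have := hH₂ (hH₁ hb)
          exact lt_of_le_of_ne (A.min'_le b (Finset.mem_of_mem_erase this))
            (Finset.ne_of_mem_erase this).symm
        have haH : a ∉ H₁ := fun h => lt_irrefl _ (hlt a h)
        refine ⟨insert a H₁, ?_, by rw [Finset.card_insert_of_notMem haH, hc₁],
          Function.update f a x, fun b S hS hbS hsub => ?_⟩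
        · intro b hb
          rcases Finset.mem_insert.1 hb with rfl | hb
          · exact A.min'_mem hne
          · exact Finset.mem_of_mem_erase (hH₂ (hH₁ hb))
        · have hbm := hsub (Finset.mem_insert_self b S)
          have hSH : S ⊆ H₁ := by
            intro y hy
            have h1 := hsub (Finset.mem_insert_of_mem hy)
            rcases Finset.mem_insert.1 h1 with rfl | h1
            · rcases Finset.mem_insert.1 hbm with h2 | h2
              · exact absurd (hbS _ hy) (by omega)
              · exact absurd (hbS _ hy) (by have := hlt _ h2; omega)
            · exact h1
          rcases Finset.mem_insert.1 hbm with rfl | hb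
          · rw [Function.update_self]
            exact hx S (hSH.trans hH₁) hS
          · rw [Function.update_of_ne (ne_of_mem_of_not_mem hb haH)]
            exact hf b S hS hbS (Finset.insert_subset hb hSH)
    have := Fintype.ofFinite κ
    classical
    obtain ⟨N, hN⟩ := key (Fintype.card κ * M)
    refine ⟨N, fun A hA c => ?_⟩
    obtain ⟨H, hH, hc, f, hf⟩ := hN A hA c
    have : Nonempty κ := ⟨c ∅⟩
    obtain ⟨x, -, hx⟩ := Finset.exists_le_card_fiber_of_mul_le_card_of_maps_to
      (s := H) (t := (Finset.univ : Finset κ)) (f := f) (n := M) (fun _ _ => Finset.mem_univ _)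
      Finset.univ_nonempty (by rw [Finset.card_univ, hc])
    obtain ⟨H', hH', hc'⟩ := Finset.exists_subset_card_eq hx
    refine ⟨H', fun y hy => hH (Finset.mem_filter.1 (hH' hy)).1, hc', x, fun S hS hSc => ?_⟩
    have hne : S.Nonempty := Finset.card_pos.1 (by omega)
    have hmem := S.min'_mem hne
    have hcol := hf (S.min' hne) (S.erase (S.min' hne))
      (by rw [Finset.card_erase_of_mem hmem]; omega)
      (fun b hb => lt_of_le_of_ne (S.min'_le b (Finset.mem_of_mem_erase hb))
            (Finset.ne_of_mem_erase hb).symm)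
      (by rw [Finset.insert_erase hmem]; exact fun y hy => (Finset.mem_filter.1 (hH' (hS hy))).1)
    rw [Finset.insert_erase hmem] at hcol
    rw [hcol]
    exact (Finset.mem_filter.1 (hH' (hS hmem))).2

theorem eq_of_bijective_of_lt_iff_lt {ι : Type*} [Fintype ι] {n : ℕ} {f g : ι → Fin n}
    (hf : f.Bijective) (hg : g.Bijective) (h : ∀ i j, f i < f j ↔ g i < g j) : f = g := by
  have rank : ∀ {f : ι → Fin n}, f.Bijective → ∀ i,
      (Finset.univ.filter fun j => f j < f i).card = f i := by
    intro f hf i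
    rw [← Fin.card_Iio (f i)]
    refine Finset.card_bij (fun j _ => f j) (by simp) (fun _ _ _ _ h => hf.1 h) fun b hb => ?_
    obtain ⟨j, rfl⟩ := hf.2 b
    exact ⟨j, by simpa using hb, rfl⟩
  funext i
  apply Fin.ext
  rw [← rank hf, ← rank hg]
  simp only [h]

theorem exists_orderInvariant_embedding (ι κ : Type) [Fintype ι] [Finite κ] (M : ℕ) :
    ∃ N : ℕ, ∀ C : (ι → ℕ) → κ, ∃ φ : ℕ → ℕ,
      (∀ i j, i < M → j < M → (φ i < φ j ↔ i < j)) ∧ (∀ i < M, φ i < N) ∧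
      ∀ v w : ι → ℕ, v.Injective → w.Injective → (∀ i, v i < M) → (∀ i, w i < M) →
        (∀ i j, v i < v j ↔ w i < w j) → C (φ ∘ v) = C (φ ∘ w) := by
  classical
  obtain ⟨N, hN⟩ := exists_homogeneous_finset (Fintype.card ι)
    ((ι → Fin (Fintype.card ι)) → κ) M
  refine ⟨N, fun C => ?_⟩
  obtain ⟨H, hH, hc, x, hx⟩ := hN (Finset.range N) (by simp) fun S π =>
    if h : S.card = Fintype.card ι then C fun i => S.orderEmbOfFin h (π i) else C fun _ => 0
  set φ : ℕ → ℕ := fun i => if h : i < M then H.orderEmbOfFin hc ⟨i, h⟩ else 0 with hφ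
  have hφlt : ∀ i j, i < M → j < M → (φ i < φ j ↔ i < j) := by
    intro i j hi hj
    simp [hφ, hi, hj]
  have hφH : ∀ i < M, φ i ∈ H := fun i hi => by
    simp only [hφ, hi, dif_pos]; exact H.orderEmbOfFin_mem hc _
  have main : ∀ v : ι → ℕ, v.Injective → (∀ i, v i < M) →
      ∃ π : ι → Fin (Fintype.card ι), π.Bijective ∧ (∀ i j, π i < π j ↔ v i < v j) ∧
        C (φ ∘ v) = x π := by
    intro v hv hvM
    have hinj : (φ ∘ v).Injective := by
      intro i j hij
      by_contra hne
      rcases lt_or_gt_of_ne (hv.ne hne) with h | h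
      · exact ((hφlt _ _ (hvM i) (hvM j)).2 h).ne hij
      · exact ((hφlt _ _ (hvM j) (hvM i)).2 h).ne' hij
    set S := Finset.univ.image (φ ∘ v) with hS
    have hSc : S.card = Fintype.card ι := by
      rw [hS, Finset.card_image_of_injective _ hinj, Finset.card_univ]
    have hSH : S ⊆ H := by
      intro y hy
      obtain ⟨i, -, rfl⟩ := Finset.mem_image.1 hy
      exact hφH _ (hvM i)
    set e := S.orderIsoOfFin hSc
    have hmem : ∀ i, φ (v i) ∈ S := fun i => Finset.mem_image_of_mem (φ ∘ v) (Finset.mem_univ i)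
    have hπinj : (fun i => e.symm ⟨φ (v i), hmem i⟩).Injective := by
      intro i j hij
      exact hinj (congrArg Subtype.val (e.symm.injective hij))
    refine ⟨fun i => e.symm ⟨φ (v i), hmem i⟩, ?_, ?_, ?_⟩
    · exact (Fintype.bijective_iff_injective_and_card _).2 ⟨hπinj, by simp⟩
    · intro i j
      rw [OrderIso.lt_iff_lt, Subtype.mk_lt_mk, hφlt _ _ (hvM i) (hvM j)]
    · rw [← hx S hSH hSc]
      simp only [hSc, dif_pos]
      congr 1
      funext i
      have : (e (e.symm ⟨φ (v i), hmem i⟩) : ℕ) = φ (v i) := by simp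
      exact this.symm
  refine ⟨φ, hφlt, fun i hi => Finset.mem_range.1 (hH (hφH i hi)), fun v w hv hw hvM hwM h => ?_⟩
  obtain ⟨π, hπ, hπv, hCv⟩ := main v hv hvM
  obtain ⟨π', hπ', hπw, hCw⟩ := main w hw hwM
  rw [hCv, hCw, eq_of_bijective_of_lt_iff_lt hπ hπ' fun i j => by rw [hπv, hπw, h]]

noncomputable section

theorem expect_mul_of_dependsOn_compl {ι S : Type*} [Fintype ι] [DecidableEq ι] [Fintype S]
    (p : ι → Prop) {f h : (ι → S) → ℝ}
    (hf : ∀ s s', (∀ i, p i → s i = s' i) → f s = f s')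
    (hh : ∀ s s', (∀ i, ¬ p i → s i = s' i) → h s = h s') :
    Finset.expect Finset.univ (fun s => f s * h s) =
      Finset.expect Finset.univ f * Finset.expect Finset.univ h := by
  classical
  rcases isEmpty_or_nonempty (ι → S) with he | hne
  · simp
  let mix : (ι → S) × (ι → S) → (ι → S) × (ι → S) := fun z =>
    (fun i => if p i then z.1 i else z.2 i, fun i => if p i then z.2 i else z.1 i)
  have hmix : Function.Involutive mix := by
    rintro ⟨s, s'⟩
    ext i <;> by_cases hi : p i <;> simp [mix, hi]
  rw [Fintype.expect_mul_expect, ← Finset.expect_product', Finset.univ_product_univ]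
  rw [Fintype.expect_equiv hmix.toPerm (fun z => f z.1 * h z.2) (fun z => f z.1 * h z.1)]
  · rw [← Finset.univ_product_univ, Finset.expect_product]
    simp
  · rintro ⟨s, s'⟩
    simp only [Function.Involutive.coe_toPerm, mix]
    rw [hf s (fun i => if p i then s i else s' i) (fun i hi => by simp [hi]),
      hh s' (fun i => if p i then s i else s' i) (fun i hi => by simp [hi])]

theorem expect_prod_of_dependsOn_fiber {ι S G : Type*} [Fintype ι] [DecidableEq ι] [Fintype S]
    [Nonempty S] (γ : ι → G) {f : G → (ι → S) → ℝ}
    (hf : ∀ g s s', (∀ i, γ i = g → s i = s' i) → f g s = f g s') (A : Finset G) :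
    Finset.expect Finset.univ (fun s => ∏ g ∈ A, f g s) =
      ∏ g ∈ A, Finset.expect Finset.univ (f g) := by
  classical
  induction A using Finset.induction_on with
  | empty => simp
  | insert g A hg ih =>
    simp only [Finset.prod_insert hg]
    rw [expect_mul_of_dependsOn_compl (fun i => γ i = g) (hf g), ih]
    intro s s' h
    refine Finset.prod_congr rfl fun g' hg' => hf g' s s' fun i hi => h i ?_
    rw [hi]
    exact ne_of_mem_of_not_mem hg' hg

theorem expect_abs_prod_sub_one_le {ι S G : Type*} [Fintype ι] [DecidableEq ι] [Fintype S]
    [Nonempty S] [Fintype G] (γ : ι → G) {r : G → (ι → S) → ℝ} {X : G → ℝ} {κ : ℝ}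
    (hr : ∀ g s s', (∀ i, γ i = g → s i = s' i) → r g s = r g s')
    (hr0 : ∀ g s, 0 ≤ r g s) (hr1 : ∀ g, Finset.expect Finset.univ (r g) = 1)
    (hr2 : ∀ g, Finset.expect Finset.univ (fun s => r g s ^ 2) ≤ 1 + X g)
    (hX : ∀ g, 0 ≤ X g) (hκ : 0 < κ) (hκ1 : κ ≤ 1) :
    Finset.expect Finset.univ (fun s => |∏ g, r g s - 1|) ≤ κ + 2 / κ * ∑ g, X g := by
  have hS : 0 ≤ ∑ g, X g := Finset.sum_nonneg fun g _ => hX g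
  set Y := ∑ g, X g with hY
  have hm : Finset.expect Finset.univ (fun s => ∏ g, r g s) = 1 := by
    rw [expect_prod_of_dependsOn_fiber γ hr]; simp [hr1]
  rcases le_or_gt Y 1 with h1 | h1
  · have hsq : Finset.expect Finset.univ (fun s => (∏ g, r g s) ^ 2) ≤ Real.exp Y := by
      simp only [← Finset.prod_pow]
      rw [expect_prod_of_dependsOn_fiber γ (f := fun g s => r g s ^ 2)
        fun g s s' h => by simp only [hr g s s' h]]
      rw [hY, Real.exp_sum]
      refine Finset.prod_le_prod (fun g _ => Finset.expect_nonneg fun s _ => sq_nonneg _)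
        fun g _ => (hr2 g).trans ?_
      rw [add_comm]; exact Real.add_one_le_exp _
    have hexp : Real.exp Y - 1 ≤ 2 * Y := by
      have := Real.abs_exp_sub_one_le (x := Y) (by rwa [abs_of_nonneg hS])
      rw [abs_of_nonneg hS] at this
      exact (le_abs_self _).trans this
    have hpt : ∀ s, |∏ g, r g s - 1| ≤
        κ / 2 + (1 / (2 * κ)) * ((∏ g, r g s) ^ 2 - 2 * ∏ g, r g s + 1) := by
      intro s
      set z := ∏ g, r g s
      have h2 : 0 ≤ (|z - 1| - κ) ^ 2 := sq_nonneg _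
      have h3 : |z - 1| ^ 2 = z ^ 2 - 2 * z + 1 := by rw [sq_abs]; ring
      rw [← h3]
      have : κ / 2 + 1 / (2 * κ) * |z - 1| ^ 2 - |z - 1| = (|z - 1| - κ) ^ 2 / (2 * κ) := by
        field_simp; ring
      have h4 : 0 ≤ (|z - 1| - κ) ^ 2 / (2 * κ) := by positivity
      linarith
    refine (Finset.expect_le_expect fun s _ => hpt s).trans ?_
    rw [Finset.expect_add_distrib, ← Finset.mul_expect, Finset.expect_add_distrib,
      Finset.expect_sub_distrib, ← Finset.mul_expect, hm, Fintype.expect_const,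
      Fintype.expect_const]
    have h5 : 1 / (2 * κ) * (Finset.expect Finset.univ (fun s => (∏ g, r g s) ^ 2) - 2 * 1 + 1)
        ≤ 1 / (2 * κ) * (2 * Y) := by
      refine mul_le_mul_of_nonneg_left (by linarith) (by positivity)
    have h6 : 1 / (2 * κ) * (2 * Y) = 1 / κ * Y := by field_simp
    have h7 : 2 / κ * Y = 1 / κ * Y + 1 / κ * Y := by ring
    have h8 : 0 ≤ 1 / κ * Y := by positivity
    linarith
  · have hpt : ∀ s, |∏ g, r g s - 1| ≤ ∏ g, r g s + 1 := by
      intro s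
      have : 0 ≤ ∏ g, r g s := Finset.prod_nonneg fun g _ => hr0 g s
      rw [abs_le]; constructor <;> linarith
    refine (Finset.expect_le_expect fun s _ => hpt s).trans ?_
    rw [Finset.expect_add_distrib, hm, Fintype.expect_const]
    have : 2 ≤ 2 / κ := by rw [le_div_iff₀ hκ]; linarith
    nlinarith

/-- The sign `±1` encoded by a Boolean. -/
def boolSign (b : Bool) : ℝ := if b then 1 else -1

/-- The sign of the arc of a diamond lying in the quadrant `s`. -/
def arcSign (s : Bool × Bool) : ℝ := boolSign s.1 * boolSign s.2

theorem boolSign_not (b : Bool) : boolSign (!b) = -boolSign b := by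
  cases b <;> simp [boolSign]

theorem abs_boolSign (b : Bool) : |boolSign b| = 1 := by
  cases b <;> simp [boolSign]

theorem abs_arcSign (s : Bool × Bool) : |arcSign s| = 1 := by
  rw [arcSign, abs_mul, abs_boolSign, abs_boolSign, mul_one]

/-- The average of `∏ (1 + η x i)` over `η = ±1`. -/
def signAverage {ι : Type*} (I : Finset ι) (x : ι → ℝ) : ℝ :=
  (∏ i ∈ I, (1 + x i) + ∏ i ∈ I, (1 - x i)) / 2

/-- The samples lying in the bin `β`. -/
abbrev binSamples {ι β : Type*} [Fintype ι] [DecidableEq β] (a : ι → β) (b : β) : Finset ι :=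
  Finset.univ.filter fun i => a i = b

theorem signAverage_congr {ι : Type*} {I : Finset ι} {x y : ι → ℝ} (h : ∀ i ∈ I, x i = y i) :
    signAverage I x = signAverage I y := by
  unfold signAverage
  rw [Finset.prod_congr rfl fun i hi => by rw [h i hi],
    Finset.prod_congr rfl fun i hi => show 1 - x i = 1 - y i by rw [h i hi]]

theorem signAverage_eq_one_of_eq_zero {ι : Type*} {I : Finset ι} {x : ι → ℝ}
    (h : ∀ i ∈ I, x i = 0) : signAverage I x = 1 := by
  rw [signAverage_congr h]; simp [signAverage]

theorem signAverage_nonneg {ι : Type*} {I : Finset ι} {x : ι → ℝ} (h : ∀ i ∈ I, |x i| ≤ 1) :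
    0 ≤ signAverage I x := by
  unfold signAverage
  have h1 : 0 ≤ ∏ i ∈ I, (1 + x i) :=
    Finset.prod_nonneg fun i hi => by linarith [(abs_le.1 (h i hi)).1]
  have h2 : 0 ≤ ∏ i ∈ I, (1 - x i) :=
    Finset.prod_nonneg fun i hi => by linarith [(abs_le.1 (h i hi)).2]
  linarith

theorem signAverage_le {ι : Type*} {I : Finset ι} {x : ι → ℝ} (h : ∀ i ∈ I, |x i| ≤ 1) :
    signAverage I x ≤ 2 ^ I.card := by
  unfold signAverage
  have h1 : ∏ i ∈ I, (1 + x i) ≤ ∏ i ∈ I, 2 :=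
    Finset.prod_le_prod (fun i hi => by linarith [(abs_le.1 (h i hi)).1])
      fun i hi => by linarith [(abs_le.1 (h i hi)).2]
  have h2 : ∏ i ∈ I, (1 - x i) ≤ ∏ i ∈ I, 2 :=
    Finset.prod_le_prod (fun i hi => by linarith [(abs_le.1 (h i hi)).2])
      fun i hi => by linarith [(abs_le.1 (h i hi)).1]
  rw [Finset.prod_const] at h1 h2
  linarith

theorem expect_prod_boolSign {ι β : Type*} [Fintype ι] [Fintype β] [DecidableEq β]
    (a : ι → β) (x : ι → ℝ) :
    Finset.expect Finset.univ (fun ξ : β → Bool => ∏ i, (1 + boolSign (ξ (a i)) * x i)) =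
      ∏ b, signAverage (binSamples a b) x := by
  have h1 : ∀ b, signAverage (binSamples a b) x =
      (1 / 2) * ∑ v : Bool, ∏ i ∈ binSamples a b, (1 + boolSign v * x i) := by
    intro b
    simp [signAverage, boolSign, sub_eq_add_neg]
    ring
  simp only [h1]
  rw [Finset.prod_mul_distrib, Finset.prod_univ_sum, Fintype.piFinset_univ,
    Finset.expect_eq_sum_div_card]
  have h2 : ∀ ξ : β → Bool, ∏ i, (1 + boolSign (ξ (a i)) * x i) =
      ∏ b, ∏ i ∈ binSamples a b, (1 + boolSign (ξ b) * x i) := by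
    intro ξ
    rw [← Finset.prod_fiberwise Finset.univ a]
    refine Finset.prod_congr rfl fun b _ => Finset.prod_congr rfl fun i hi => ?_
    rw [(Finset.mem_filter.1 hi).2]
  simp only [h2]
  simp
  ring

section Flip

variable {ι : Type*} [Fintype ι] [DecidableEq ι]

theorem sum_update_eq_zero {S : Type*} [Fintype S] [DecidableEq S] (j : ι) {f : S → S}
    (hf : Function.Involutive f) {H : (ι → S) → ℝ}
    (hH : ∀ s, H (Function.update s j (f (s j))) = -H s) : ∑ s, H s = 0 := by
  have hinv : Function.Involutive fun s : ι → S => Function.update s j (f (s j)) := by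
    intro s
    simp [hf (s j)]
  have := Equiv.sum_comp hinv.toPerm H
  simp only [Function.Involutive.coe_toPerm, hH, Finset.sum_neg_distrib] at this
  linarith

theorem expect_arcSign (i : ι) :
    Finset.expect Finset.univ (fun s : ι → Bool × Bool => arcSign (s i)) = 0 := by
  rw [Finset.expect_eq_sum_div_card, sum_update_eq_zero i (f := fun v => (!v.1, v.2)), zero_div]
  · intro v; simp
  · intro s; simp [arcSign, boolSign_not]

theorem expect_signAverage (I : Finset ι) (y : ι → ℝ) :
    Finset.expect Finset.univ
      (fun s : ι → Bool × Bool => signAverage I fun i => y i * arcSign (s i)) = 1 := by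
  have key : ∀ y : ι → ℝ, Finset.expect Finset.univ
      (fun s : ι → Bool × Bool => ∏ i ∈ I, (1 + y i * arcSign (s i))) = 1 := by
    intro y
    rw [expect_prod_of_dependsOn_fiber id
      (f := fun i (s : ι → Bool × Bool) => 1 + y i * arcSign (s i))]
    · refine Finset.prod_eq_one fun i _ => ?_
      rw [Finset.expect_add_distrib, ← Finset.mul_expect, expect_arcSign]
      simp
    · intro i s s' h
      simp only [h i rfl]
  unfold signAverage
  rw [← Finset.expect_div, Finset.expect_add_distrib, key y]
  have := key fun i => -y i
  simp only [neg_mul, ← sub_eq_add_neg] at this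
  rw [this]; norm_num

variable {β : Type*} [DecidableEq β]

/-- Invariance of a function of the signs under the flips which do not affect the relative order
of the samples: a horizontal flip of the sample of least radius in its bin, and a vertical flip of
the sample of greatest radius in its bin. -/
def FlipInvariant {U : ℕ} (a : ι → β) (u : ι → Fin U) (F : (ι → Bool × Bool) → ℝ) : Prop :=
  (∀ j, (∀ l, a l = a j → l ≠ j → u j < u l) →
    ∀ s, F (Function.update s j (!(s j).1, (s j).2)) = F s) ∧
  (∀ j, (∀ l, a l = a j → l ≠ j → u l < u j) →
    ∀ s, F (Function.update s j ((s j).1, !(s j).2)) = F s)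

theorem FlipInvariant.sum_mul_pair_eq_zero {U : ℕ} {a : ι → β} {u : ι → Fin U}
    {F R : (ι → Bool × Bool) → ℝ} (hF : FlipInvariant a u F) (y : ι → ℝ) {j l : ι} (hjl : j ≠ l)
    (hR : ∀ s s', (∀ i, a i ≠ a j → s i = s' i) → R s = R s')
    (hj : (∀ l, a l = a j → l ≠ j → u j < u l) ∨ (∀ l, a l = a j → l ≠ j → u l < u j)) :
    ∑ s, F s * (R s * ((y j * arcSign (s j)) * (y l * arcSign (s l)))) = 0 := by
  have hR' : ∀ s v, R (Function.update s j v) = R s := by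
    intro s v
    refine hR _ _ fun i hi => ?_
    rw [Function.update_of_ne]
    rintro rfl
    exact hi rfl
  rcases hj with hj | hj
  · refine sum_update_eq_zero j (f := fun v => (!v.1, v.2)) (fun v => by simp) fun s => ?_
    rw [hF.1 j hj, hR', Function.update_self, Function.update_of_ne hjl.symm]
    simp only [arcSign, boolSign_not]; ring
  · refine sum_update_eq_zero j (f := fun v => (v.1, !v.2)) (fun v => by simp) fun s => ?_
    rw [hF.2 j hj, hR', Function.update_self, Function.update_of_ne hjl.symm]
    simp only [arcSign, boolSign_not]; ring

theorem FlipInvariant.sum_mul_signAverage_sub_one_eq_zero {U : ℕ} {a : ι → β} {u : ι → Fin U}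
    (hu : u.Injective) {F R : (ι → Bool × Bool) → ℝ} (hF : FlipInvariant a u F) (y : ι → ℝ) {b : β}
    (hR : ∀ s s', (∀ i, a i ≠ b → s i = s' i) → R s = R s') (hb : (binSamples a b).card ≤ 3) :
    ∑ s, F s * (R s * (signAverage (binSamples a b) (fun i => y i * arcSign (s i)) - 1)) = 0 := by
  have pair : ∀ j l, a j = b → a l = b → j ≠ l →
      ((∀ i, a i = b → i ≠ j → u j < u i) ∨ (∀ i, a i = b → i ≠ j → u i < u j) ∨
        (∀ i, a i = b → i ≠ l → u l < u i) ∨ (∀ i, a i = b → i ≠ l → u i < u l)) →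
      ∑ s, F s * (R s * ((y j * arcSign (s j)) * (y l * arcSign (s l)))) = 0 := by
    intro j l hj hl hjl h
    rcases h with h | h | h | h
    · exact hF.sum_mul_pair_eq_zero y hjl (by rwa [hj]) (Or.inl (by rwa [hj]))
    · exact hF.sum_mul_pair_eq_zero y hjl (by rwa [hj]) (Or.inr (by rwa [hj]))
    · simp only [mul_comm (y j * _)]
      exact hF.sum_mul_pair_eq_zero y hjl.symm (by rwa [hl]) (Or.inl (by rwa [hl]))
    · simp only [mul_comm (y j * _)]
      exact hF.sum_mul_pair_eq_zero y hjl.symm (by rwa [hl]) (Or.inr (by rwa [hl]))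
  have hmem : ∀ i, a i = b ↔ i ∈ binSamples a b := by simp
  have hne : ∀ i j, i ≠ j → (u i : ℕ) ≠ u j := fun i j h h' => h (hu (Fin.ext h'))
  interval_cases hc : (binSamples a b).card
  · rw [Finset.card_eq_zero.1 hc]; simp [signAverage]
  · obtain ⟨i, hi⟩ := Finset.card_eq_one.1 hc
    rw [hi]; simp [signAverage]
  · obtain ⟨i, j, hij, h⟩ := Finset.card_eq_two.1 hc
    rw [h] at hmem ⊢
    have hi : a i = b := (hmem i).2 (by simp)
    have hj : a j = b := (hmem j).2 (by simp)
    rw [← pair i j hi hj hij ?_]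
    · refine Finset.sum_congr rfl fun s _ => ?_
      simp only [signAverage, Finset.prod_pair hij]
      ring
    · have h1 := hne i j hij
      simp only [hmem, Finset.mem_insert, Finset.mem_singleton, Fin.lt_def]
      rcases lt_or_gt_of_ne h1 with h2 | h2
      · left; rintro l (rfl | rfl) hl
        · exact absurd rfl hl
        · exact h2
      · right; left; rintro l (rfl | rfl) hl
        · exact absurd rfl hl
        · exact h2
  · obtain ⟨i, j, k, hij, hik, hjk, h⟩ := Finset.card_eq_three.1 hc
    rw [h] at hmem ⊢
    have hi : a i = b := (hmem i).2 (by simp)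
    have hj : a j = b := (hmem j).2 (by simp)
    have hk : a k = b := (hmem k).2 (by simp)
    have hext : ∀ i j k : ι, i ≠ j → i ≠ k → j ≠ k → (∀ l, a l = b ↔ l = i ∨ l = j ∨ l = k) →
        ((∀ l, a l = b → l ≠ i → u i < u l) ∨ (∀ l, a l = b → l ≠ i → u l < u i) ∨
        (∀ l, a l = b → l ≠ j → u j < u l) ∨ (∀ l, a l = b → l ≠ j → u l < u j)) := by
      intro i j k hij hik hjk hm
      have h1 := hne i j hij
      have h2 := hne i k hik
      have h3 := hne j k hjk
      simp only [hm, Fin.lt_def]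
      have : ((u i : ℕ) < u j ∧ (u i : ℕ) < u k) ∨ ((u j : ℕ) < u i ∧ (u k : ℕ) < u i) ∨
        ((u j : ℕ) < u i ∧ (u j : ℕ) < u k) ∨ ((u i : ℕ) < u j ∧ (u k : ℕ) < u j) := by omega
      rcases this with h | h | h | h
      · left; rintro l (rfl | rfl | rfl) hl
        exacts [absurd rfl hl, h.1, h.2]
      · right; left; rintro l (rfl | rfl | rfl) hl
        exacts [absurd rfl hl, h.1, h.2]
      · right; right; left; rintro l (rfl | rfl | rfl) hl
        exacts [h.1, absurd rfl hl, h.2]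
      · right; right; right; rintro l (rfl | rfl | rfl) hl
        exacts [h.1, absurd rfl hl, h.2]
    have e1 := pair i j hi hj hij (hext i j k hij hik hjk fun l => by rw [hmem]; simp)
    have e2 := pair i k hi hk hik (hext i k j hik hij hjk.symm fun l => by
      rw [hmem]; simp only [Finset.mem_insert, Finset.mem_singleton]; tauto)
    have e3 := pair j k hj hk hjk (hext j k i hjk hij.symm hik.symm fun l => by
      rw [hmem]; simp only [Finset.mem_insert, Finset.mem_singleton]; tauto)
    calc _ = ∑ s, (F s * (R s * ((y i * arcSign (s i)) * (y j * arcSign (s j)))) +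
          F s * (R s * ((y i * arcSign (s i)) * (y k * arcSign (s k)))) +
          F s * (R s * ((y j * arcSign (s j)) * (y k * arcSign (s k))))) := by
          refine Finset.sum_congr rfl fun s _ => ?_
          have hi' : i ∉ ({j, k} : Finset ι) := by simp [hij, hik]
          simp only [signAverage, Finset.prod_insert hi', Finset.prod_pair hjk]
          ring
      _ = 0 := by rw [Finset.sum_add_distrib, Finset.sum_add_distrib, e1, e2, e3]; simp

end Flip

section Configuration

variable {ι G β : Type*} [Fintype ι] [DecidableEq ι] [Fintype G] [DecidableEq G] [Fintype β]
  [DecidableEq β]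

/-- The likelihood ratio of the signs in the bins outside `T`. -/
def binRatio (T : Finset (G × β)) (a : ι → G × β) (y : ι → ℝ) (s : ι → Bool × Bool) (b : G × β) :
    ℝ :=
  if b ∈ T then 1 else signAverage (binSamples a b) fun i => y i * arcSign (s i)

theorem binRatio_congr (T : Finset (G × β)) (a : ι → G × β) (y : ι → ℝ) (b : G × β)
    {s s' : ι → Bool × Bool} (h : ∀ i, a i = b → s i = s' i) :
    binRatio T a y s b = binRatio T a y s' b := by
  unfold binRatio
  split_ifs
  · rfl
  · exact signAverage_congr fun i hi => by rw [h i (Finset.mem_filter.1 hi).2]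

theorem abs_mul_arcSign_le {y : ℝ} (hy : |y| ≤ 1) (s : Bool × Bool) : |y * arcSign s| ≤ 1 := by
  rw [abs_mul, abs_arcSign, mul_one]; exact hy

theorem binRatio_nonneg (T : Finset (G × β)) (a : ι → G × β) {y : ι → ℝ} (hy : ∀ i, |y i| ≤ 1)
    (s : ι → Bool × Bool) (b : G × β) : 0 ≤ binRatio T a y s b := by
  unfold binRatio
  split_ifs
  · exact zero_le_one
  · exact signAverage_nonneg fun i _ => abs_mul_arcSign_le (hy i) _

theorem binRatio_le (T : Finset (G × β)) (a : ι → G × β) {y : ι → ℝ} (hy : ∀ i, |y i| ≤ 1)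
    (s : ι → Bool × Bool) (b : G × β) : binRatio T a y s b ≤ 2 ^ (binSamples a b).card := by
  unfold binRatio
  split_ifs
  · exact one_le_pow₀ one_le_two
  · exact signAverage_le fun i _ => abs_mul_arcSign_le (hy i) _

theorem expect_binRatio (T : Finset (G × β)) (a : ι → G × β) (y : ι → ℝ) (b : G × β) :
    Finset.expect Finset.univ (fun s => binRatio T a y s b) = 1 := by
  unfold binRatio
  split_ifs
  · simp
  · exact expect_signAverage _ _

theorem expect_prod_binRatio (T : Finset (G × β)) (a : ι → G × β) (y : ι → ℝ) (g : G) :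
    Finset.expect Finset.univ (fun s => ∏ b, binRatio T a y s (g, b)) = 1 := by
  have : ∀ s, ∏ b, binRatio T a y s (g, b) =
      ∏ b ∈ ({g} : Finset G) ×ˢ (Finset.univ : Finset β), binRatio T a y s b := by
    intro s
    rw [Finset.prod_product, Finset.prod_singleton]
  simp only [this]
  rw [expect_prod_of_dependsOn_fiber a (f := fun b s => binRatio T a y s b)
    fun b s s' h => binRatio_congr T a y b h]
  exact Finset.prod_eq_one fun b _ => expect_binRatio T a y b

theorem prod_binRatio_le (T : Finset (G × β)) (a : ι → G × β) {y : ι → ℝ} (hy : ∀ i, |y i| ≤ 1)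
    (s : ι → Bool × Bool) (g : G) :
    ∏ b, binRatio T a y s (g, b) ≤ 2 ^ (Finset.univ.filter fun i => (a i).1 = g).card := by
  have h1 : (Finset.univ.filter fun i => (a i).1 = g).card =
      ∑ b, (binSamples a (g, b)).card := by
    rw [Finset.card_eq_sum_card_fiberwise (f := fun i => (a i).2) (t := Finset.univ) (by simp)]
    refine Finset.sum_congr rfl fun b _ => congrArg Finset.card ?_
    ext i
    simp [Prod.ext_iff]
  rw [h1, ← Finset.prod_pow_eq_pow_sum]
  exact Finset.prod_le_prod (fun b _ => binRatio_nonneg T a hy s _)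
    fun b _ => binRatio_le T a hy s _

theorem FlipInvariant.sum_mul_prod_eq {U : ℕ} {a : ι → G × β} {u : ι → Fin U}
    (hu : u.Injective) {F : (ι → Bool × Bool) → ℝ} (hF : FlipInvariant a u F) (y : ι → ℝ)
    (A B : G → ℝ) (T : Finset (G × β)) (hT : ∀ b ∈ T, (binSamples a b).card ≤ 3) :
    ∑ s, F s * ∏ g, (A g + B g * ∏ b, binRatio ∅ a y s (g, b)) =
      ∑ s, F s * ∏ g, (A g + B g * ∏ b, binRatio T a y s (g, b)) := by
  induction T using Finset.induction_on with
  | empty => rfl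
  | insert b T hb ih =>
    rw [ih fun b' hb' => hT b' (Finset.mem_insert_of_mem hb'), ← sub_eq_zero,
      ← Finset.sum_sub_distrib]
    obtain ⟨g₀, b₀⟩ := b
    set R : (ι → Bool × Bool) → ℝ := fun s =>
      (∏ g ∈ Finset.univ.erase g₀, (A g + B g * ∏ b, binRatio T a y s (g, b))) *
        (B g₀ * ∏ b ∈ Finset.univ.erase b₀, binRatio T a y s (g₀, b)) with hR
    rw [← hF.sum_mul_signAverage_sub_one_eq_zero hu y (R := R) ?_
      (hT _ (Finset.mem_insert_self _ _))]
    · refine Finset.sum_congr rfl fun s _ => ?_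
      have hne : ∀ g b, (g, b) ≠ (g₀, b₀) →
          binRatio (insert (g₀, b₀) T) a y s (g, b) = binRatio T a y s (g, b) := by
        intro g b h
        simp [binRatio, h]
      have h1 : binRatio (insert (g₀, b₀) T) a y s (g₀, b₀) = 1 := by simp [binRatio]
      have h2 : binRatio T a y s (g₀, b₀) =
          signAverage (binSamples a (g₀, b₀)) fun i => y i * arcSign (s i) := by
        simp [binRatio, hb]
      have e1 : ∏ b ∈ Finset.univ.erase b₀, binRatio (insert (g₀, b₀) T) a y s (g₀, b) =
          ∏ b ∈ Finset.univ.erase b₀, binRatio T a y s (g₀, b) :=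
        Finset.prod_congr rfl fun b hb => hne g₀ b fun h =>
          (Finset.ne_of_mem_erase hb) (Prod.ext_iff.1 h).2
      have e2 : ∏ g ∈ Finset.univ.erase g₀,
            (A g + B g * ∏ b, binRatio (insert (g₀, b₀) T) a y s (g, b)) =
          ∏ g ∈ Finset.univ.erase g₀, (A g + B g * ∏ b, binRatio T a y s (g, b)) := by
        refine Finset.prod_congr rfl fun g hg => ?_
        rw [Finset.prod_congr rfl fun b _ => hne g b fun h =>
          (Finset.ne_of_mem_erase hg) (Prod.ext_iff.1 h).1]
      rw [← Finset.mul_prod_erase _ _ (Finset.mem_univ g₀),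
        ← Finset.mul_prod_erase _ (fun g => A g + B g * ∏ b, binRatio (insert (g₀, b₀) T) a y s (g, b))
          (Finset.mem_univ g₀),
        ← Finset.mul_prod_erase _ (fun b => binRatio T a y s (g₀, b)) (Finset.mem_univ b₀),
        ← Finset.mul_prod_erase _ (fun b => binRatio (insert (g₀, b₀) T) a y s (g₀, b))
          (Finset.mem_univ b₀), h1, h2,
        e1, e2]
      simp only [hR]
      ring
    · intro s s' h
      have h' : ∀ b, b ≠ (g₀, b₀) → binRatio T a y s b = binRatio T a y s' b := fun b hb =>
        binRatio_congr T a y b fun i hi => h i (by rw [hi]; exact hb)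
      simp only [hR]
      congr 1
      · refine Finset.prod_congr rfl fun g hg => ?_
        rw [Finset.prod_congr rfl fun b _ => h' (g, b) fun h =>
            (Finset.ne_of_mem_erase hg) (Prod.ext_iff.1 h).1]
      · rw [Finset.prod_congr rfl fun b hb => h' (g₀, b) fun h =>
          (Finset.ne_of_mem_erase hb) (Prod.ext_iff.1 h).2]

/-- An upper bound for the variance of the posterior likelihood ratio in a group of bins. -/
def groupVariance (a : ι → G × β) (y : ι → ℝ) (A B : G → ℝ) (g : G) : ℝ :=
  open Classical in
  if ∀ b, (binSamples a (g, b)).card ≤ 3 ∨ ∀ i ∈ binSamples a (g, b), y i = 0 then 0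
  else (B g / (A g + B g)) ^ 2 * 4 ^ (Finset.univ.filter fun i => (a i).1 = g).card

theorem FlipInvariant.sum_mul_sub_le {U : ℕ} {a : ι → G × β} {u : ι → Fin U}
    (hu : u.Injective) {F : (ι → Bool × Bool) → ℝ} (hF : FlipInvariant a u F)
    (hF0 : ∀ s, 0 ≤ F s) (hF1 : ∀ s, F s ≤ 1) {y : ι → ℝ} (hy : ∀ i, |y i| ≤ 1)
    {A B : G → ℝ} (hA : ∀ g, 0 < A g) (hB : ∀ g, 0 ≤ B g) {κ : ℝ} (hκ : 0 < κ) (hκ1 : κ ≤ 1) :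
    ∑ s, F s * (∏ g, (A g + B g) - ∏ g, (A g + B g * ∏ b, binRatio ∅ a y s (g, b))) ≤
      4 ^ Fintype.card ι *
        ((∏ g, (A g + B g)) * (κ + 2 / κ * ∑ g, groupVariance a y A B g)) := by
  set T : Finset (G × β) := Finset.univ.filter fun b => (binSamples a b).card ≤ 3 with hT
  have hAB : ∀ g, 0 < A g + B g := fun g => add_pos_of_pos_of_nonneg (hA g) (hB g)
  have hZ : 0 < ∏ g, (A g + B g) := Finset.prod_pos fun g _ => hAB g
  set τ : G → ℝ := fun g => B g / (A g + B g) with hτ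
  have hτ0 : ∀ g, 0 ≤ τ g := fun g => div_nonneg (hB g) (hAB g).le
  have hτ1 : ∀ g, τ g ≤ 1 := fun g => (div_le_one (hAB g)).2 (by linarith [hA g])
  set Q : G → (ι → Bool × Bool) → ℝ := fun g s => ∏ b, binRatio T a y s (g, b) with hQ
  have hQ0 : ∀ g s, 0 ≤ Q g s := fun g s =>
    Finset.prod_nonneg fun b _ => binRatio_nonneg T a hy s _
  set r : G → (ι → Bool × Bool) → ℝ := fun g s => 1 + τ g * (Q g s - 1) with hr
  have hfac : ∀ s, ∏ g, (A g + B g * Q g s) = (∏ g, (A g + B g)) * ∏ g, r g s := by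
    intro s
    rw [← Finset.prod_mul_distrib]
    refine Finset.prod_congr rfl fun g _ => ?_
    have := (hAB g).ne'
    simp only [hr, hτ]
    field_simp
    ring
  have hr1 : ∀ g, Finset.expect Finset.univ (r g) = 1 := by
    intro g
    simp only [hr]
    rw [Finset.expect_add_distrib, ← Finset.mul_expect, Finset.expect_sub_distrib,
      expect_prod_binRatio]
    simp
  have hvar0 : ∀ g, 0 ≤ groupVariance a y A B g := by
    intro g
    unfold groupVariance
    split_ifs
    · exact le_rfl
    · positivity
  have hr2 : ∀ g, Finset.expect Finset.univ (fun s => r g s ^ 2) ≤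
      1 + groupVariance a y A B g := by
    intro g
    have hpt : ∀ s, r g s ^ 2 ≤ 2 * r g s - 1 + groupVariance a y A B g := by
      intro s
      have : (r g s - 1) ^ 2 ≤ groupVariance a y A B g := by
        unfold groupVariance
        split_ifs with h
        · have hQ1 : Q g s = 1 := by
            refine Finset.prod_eq_one fun b _ => ?_
            unfold binRatio
            split_ifs with hm
            · rfl
            · rcases h b with h | h
              · exact (hm (by rw [hT]; exact Finset.mem_filter.2 ⟨Finset.mem_univ _, h⟩)).elim
              · exact signAverage_eq_one_of_eq_zero fun i hi => by rw [h i hi, zero_mul]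
          simp [hr, hQ1]
        · have e : (r g s - 1) ^ 2 = τ g ^ 2 * (Q g s - 1) ^ 2 := by simp only [hr]; ring
          rw [e]
          refine mul_le_mul_of_nonneg_left ?_ (sq_nonneg _)
          have h4 : (4 : ℝ) = 2 ^ 2 := by norm_num
          rw [h4, ← pow_mul, mul_comm 2, pow_mul]
          refine sq_le_sq.2 ?_
          have h2 : Q g s ≤ 2 ^ (Finset.univ.filter fun i => (a i).1 = g).card :=
            prod_binRatio_le T a hy s g
          have h3 : (1 : ℝ) ≤ 2 ^ (Finset.univ.filter fun i => (a i).1 = g).card :=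
            one_le_pow₀ one_le_two
          rw [abs_of_nonneg (zero_le_one.trans h3), abs_le]
          constructor <;> linarith [hQ0 g s]
      linarith [this, sq_nonneg (r g s - 1), (by ring : (r g s - 1) ^ 2 = r g s ^ 2 - 2 * r g s + 1)]
    refine (Finset.expect_le_expect fun s _ => hpt s).trans ?_
    rw [Finset.expect_add_distrib, Finset.expect_sub_distrib, ← Finset.mul_expect, hr1,
      Fintype.expect_const, Fintype.expect_const]
    linarith
  have hr0 : ∀ g s, 0 ≤ r g s := by
    intro g s
    have := mul_nonneg (hτ0 g) (hQ0 g s)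
    simp only [hr]
    linarith [hτ1 g]
  have hrdep : ∀ g s s', (∀ i, (a i).1 = g → s i = s' i) → r g s = r g s' := by
    intro g s s' h
    simp only [hr, hQ]
    rw [Finset.prod_congr rfl fun b _ => binRatio_congr T a y (g, b) fun i hi => h i (by rw [hi])]
  have main := expect_abs_prod_sub_one_le (fun i => (a i).1) hrdep hr0 hr1 hr2 hvar0 hκ hκ1
  rw [Finset.expect_eq_sum_div_card, div_le_iff₀ (by simp)] at main
  have hcard : ((Finset.univ : Finset (ι → Bool × Bool)).card : ℝ) = 4 ^ Fintype.card ι := by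
    simp
  rw [hcard] at main
  simp only [mul_sub, Finset.sum_sub_distrib]
  rw [hF.sum_mul_prod_eq hu y A B T fun b hb => (Finset.mem_filter.1 hb).2,
    ← Finset.sum_sub_distrib]
  calc _ ≤ ∑ s, (∏ g, (A g + B g)) * |∏ g, r g s - 1| := by
        refine Finset.sum_le_sum fun s _ => ?_
        have := hfac s
        simp only [hQ] at this
        rw [this]
        have e : F s * ∏ g, (A g + B g) - F s * ((∏ g, (A g + B g)) * ∏ g, r g s) =
          (∏ g, (A g + B g)) * (F s * -(∏ g, r g s - 1)) := by ring
        rw [e]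
        refine mul_le_mul_of_nonneg_left ?_ hZ.le
        calc _ ≤ F s * |∏ g, r g s - 1| := mul_le_mul_of_nonneg_left (neg_le_abs _) (hF0 s)
          _ ≤ 1 * |∏ g, r g s - 1| := mul_le_mul_of_nonneg_right (hF1 s) (abs_nonneg _)
          _ = _ := one_mul _
    _ = (∏ g, (A g + B g)) * ∑ s, |∏ g, r g s - 1| := by rw [Finset.mul_sum]
    _ ≤ (∏ g, (A g + B g)) *
          ((κ + 2 / κ * ∑ g, groupVariance a y A B g) * 4 ^ Fintype.card ι) :=
        mul_le_mul_of_nonneg_left main hZ.le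
    _ = _ := by ring

end Configuration

section Groups

/-- The prior probability of a type: the type `none` has a public bin and only light bins, while
in the type `some j` the bin `j` is heavy. -/
def typeWeight (L : ℕ) (θ : ℝ) : Option (Fin L) → ℝ
  | none => 1 - θ
  | some _ => θ / L

/-- The probability of a bin in a group of given type. -/
def binWeight (L : ℕ) (lam : ℝ) : Option (Fin L) → Option (Fin L) → ℝ
  | none, none => 1 - L * lam
  | none, some _ => lam
  | some _, none => 1 / 2 - (L - 1) * lam
  | some j, some b => if b = j then 1 / 2 else lam

theorem sum_typeWeight {L : ℕ} (hL : L ≠ 0) (θ : ℝ) : ∑ t, typeWeight L θ t = 1 := by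
  have : (L : ℝ) ≠ 0 := by exact_mod_cast hL
  rw [Fintype.sum_option]
  simp only [typeWeight, Finset.sum_const, Finset.card_univ, Fintype.card_fin, nsmul_eq_mul]
  field_simp
  ring

theorem typeWeight_nonneg {L : ℕ} {θ : ℝ} (h0 : 0 ≤ θ) (h1 : θ ≤ 1) (t : Option (Fin L)) :
    0 ≤ typeWeight L θ t := by
  cases t
  · simpa [typeWeight] using h1
  · simp only [typeWeight]; positivity

theorem sum_binWeight {L : ℕ} (lam : ℝ) (t : Option (Fin L)) : ∑ b, binWeight L lam t b = 1 := by
  rw [Fintype.sum_option]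
  cases t with
  | none => simp [binWeight]
  | some j =>
    simp only [binWeight]
    rw [Finset.sum_ite, Finset.filter_eq', Finset.filter_ne']
    have : 1 ≤ L := Fin.pos j
    simp [Finset.card_erase_of_mem, Nat.cast_sub this]
    ring

section

variable {L : ℕ} {lam : ℝ}

theorem le_quarter_of_fin (h0 : 0 < lam) (hL : L * lam ≤ 1 / 4) (j : Fin L) : lam ≤ 1 / 4 := by
  have : (1 : ℝ) ≤ L := by exact_mod_cast Fin.pos j
  nlinarith

theorem binWeight_pos (h0 : 0 < lam) (hL : L * lam ≤ 1 / 4) (t b : Option (Fin L)) :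
    0 < binWeight L lam t b := by
  cases t <;> cases b <;> simp only [binWeight]
  · linarith
  · exact h0
  · linarith
  · split_ifs
    · norm_num
    · exact h0

/-- Moving mass away from the heavy bin. -/
theorem binWeight_none_le (h0 : 0 < lam) (hL : L * lam ≤ 1 / 4) (j : Fin L)
    (b : Option (Fin L)) :
    binWeight L lam none b ≤ 4 * (if b = some j then lam else 1) * binWeight L lam (some j) b := by
  have h1 := le_quarter_of_fin h0 hL j
  have h2 : 0 ≤ (L : ℝ) * lam := by positivity
  cases b with
  | none => simp only [binWeight]; simp; linarith
  | some b =>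
    simp only [binWeight, Option.some.injEq]
    split_ifs <;> linarith

/-- The weights arising from the second moment of a group of type `none` compared with the type
`some j`. -/
def momentWeight (L : ℕ) (lam : ℝ) (j : Fin L) (b : Option (Fin L)) : ℝ :=
  16 * (binWeight L lam none b * if b = some j then lam⁻¹ else 1)

theorem momentWeight_nonneg (h0 : 0 < lam) (hL : L * lam ≤ 1 / 4) (j : Fin L)
    (b : Option (Fin L)) : 0 ≤ momentWeight L lam j b := by
  have := binWeight_pos h0 hL none b
  unfold momentWeight
  split_ifs <;> positivity

theorem sum_momentWeight_le (h0 : 0 < lam) (hL : L * lam ≤ 1 / 4) (j : Fin L) :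
    ∑ b, momentWeight L lam j b ≤ 32 := by
  have h1 : ∑ b, momentWeight L lam j b ≤
      ∑ b, 16 * (binWeight L lam none b + if b = some j then 1 else 0) := by
    refine Finset.sum_le_sum fun b _ => ?_
    unfold momentWeight
    split_ifs with h
    · subst h
      simp only [binWeight, mul_inv_cancel₀ h0.ne']
      linarith
    · simp
  refine h1.trans ?_
  rw [← Finset.mul_sum, Finset.sum_add_distrib, sum_binWeight]
  simp
  norm_num

end

theorem sum_prod_sum_prod_filter_le {ι G τ β : Type*} [Fintype ι] [DecidableEq ι] [Fintype G]
    [DecidableEq G] [Fintype τ] [DecidableEq τ] [Fintype β] {p : G → τ → ℝ} {V : G → τ → β → ℝ}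
    {S : G → ℝ} (hp : ∀ g t, 0 ≤ p g t) (hp1 : ∀ g, ∑ t, p g t = 1) (hV : ∀ g t b, 0 ≤ V g t b)
    (hS : ∀ g t, ∑ b, V g t b ≤ S g) :
    ∑ a : ι → G × β, ∏ g, ∑ t, p g t * ∏ i ∈ Finset.univ.filter (fun i => (a i).1 = g),
      V g t (a i).2 ≤ (∑ g, S g) ^ Fintype.card ι := by
  have h1 : ∀ a : ι → G × β, ∏ g, ∑ t, p g t *
      ∏ i ∈ Finset.univ.filter (fun i => (a i).1 = g), V g t (a i).2 =
      ∑ T : G → τ, (∏ g, p g (T g)) * ∏ i, V (a i).1 (T (a i).1) (a i).2 := by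
    intro a
    rw [Finset.prod_univ_sum, Fintype.piFinset_univ]
    refine Finset.sum_congr rfl fun T _ => ?_
    rw [Finset.prod_mul_distrib, ← Finset.prod_fiberwise Finset.univ (fun i => (a i).1)
      (fun i => V (a i).1 (T (a i).1) (a i).2)]
    congr 1
    refine Finset.prod_congr rfl fun g _ => Finset.prod_congr rfl fun i hi => ?_
    rw [(Finset.mem_filter.1 hi).2]
  simp only [h1]
  rw [Finset.sum_comm]
  have h2 : ∀ T : G → τ, ∑ a : ι → G × β, (∏ g, p g (T g)) * ∏ i, V (a i).1 (T (a i).1) (a i).2 =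
      (∏ g, p g (T g)) * (∑ g, ∑ b, V g (T g) b) ^ Fintype.card ι := by
    intro T
    rw [← Finset.mul_sum, ← Fintype.sum_prod_type (fun z : G × β => V z.1 (T z.1) z.2),
      ← Finset.card_univ, ← Finset.prod_const, Finset.prod_univ_sum, Fintype.piFinset_univ]
  simp only [h2]
  calc _ ≤ ∑ T : G → τ, (∏ g, p g (T g)) * (∑ g, S g) ^ Fintype.card ι := by
        refine Finset.sum_le_sum fun T _ => mul_le_mul_of_nonneg_left ?_
          (Finset.prod_nonneg fun g _ => hp _ _)
        exact pow_le_pow_left₀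
          (Finset.sum_nonneg fun g _ => Finset.sum_nonneg fun b _ => hV g (T g) b)
          (Finset.sum_le_sum fun g _ => hS g (T g)) _
    _ = _ := by
        rw [← Finset.sum_mul, ← Fintype.piFinset_univ, ← Finset.prod_univ_sum]
        simp [hp1]

variable {ι G : Type*} [Fintype ι] [DecidableEq ι] [Fintype G] [DecidableEq G] {L : ℕ}

/-- The joint weight of the type `t` of the group `g` and of the bins of the samples in `g`. -/
def groupWeight (θ lam : ℝ) (a : ι → G × Option (Fin L)) (t : Option (Fin L)) (g : G) : ℝ :=
  typeWeight L θ t *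
    ∏ i ∈ Finset.univ.filter (fun i => (a i).1 = g), binWeight L lam t (a i).2

section

variable {θ lam : ℝ}

theorem groupWeight_pos (hθ0 : 0 < θ) (hθ1 : θ < 1) (h0 : 0 < lam) (hLl : L * lam ≤ 1 / 4)
    (a : ι → G × Option (Fin L)) (t : Option (Fin L)) (g : G) :
    0 < groupWeight θ lam a t g := by
  refine mul_pos ?_ (Finset.prod_pos fun i _ => binWeight_pos h0 hLl _ _)
  cases t with
  | none => simpa [typeWeight] using hθ1
  | some j =>
    have : (0 : ℝ) < L := by exact_mod_cast Fin.pos j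
    simp only [typeWeight]; positivity

theorem groupVariance_mul_le (hθ0 : 0 < θ) (hθ1 : θ < 1) (h0 : 0 < lam) (hLl : L * lam ≤ 1 / 4)
    (hL : L ≠ 0) (a : ι → G × Option (Fin L)) {y : ι → ℝ}
    (hy : ∀ i, (a i).2 = none → y i = 0) (g : G) :
    (∑ t, groupWeight θ lam a t g) *
        groupVariance a y (fun g => ∑ j, groupWeight θ lam a (some j) g)
          (groupWeight θ lam a none) g ≤
      ∑ j, L / θ * lam ^ 8 * ∏ i ∈ Finset.univ.filter (fun i => (a i).1 = g),
        momentWeight L lam j (a i).2 := by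
  have hLpos : (0 : ℝ) < L := by exact_mod_cast Nat.pos_of_ne_zero hL
  have hM : ∀ j, 0 ≤ L / θ * lam ^ 8 * ∏ i ∈ Finset.univ.filter (fun i => (a i).1 = g),
      momentWeight L lam j (a i).2 := fun j => by
    have := Finset.prod_nonneg (s := Finset.univ.filter (fun i => (a i).1 = g))
      fun i _ => momentWeight_nonneg h0 hLl j (a i).2
    positivity
  unfold groupVariance
  split_ifs with h
  · rw [mul_zero]; exact Finset.sum_nonneg fun j _ => hM j
  · push Not at h
    obtain ⟨b, hb, i₀, hi₀, hi₀'⟩ := h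
    obtain ⟨j, rfl⟩ : ∃ j, b = some j := by
      cases b with
      | none => exact absurd (hy i₀ (by simp [(Finset.mem_filter.1 hi₀).2])) hi₀'
      | some j => exact ⟨j, rfl⟩
    refine le_trans ?_ (Finset.single_le_sum (fun j _ => hM j) (Finset.mem_univ j))
    set I := Finset.univ.filter (fun i => (a i).1 = g) with hI
    have hpos := fun t => groupWeight_pos (G := G) (ι := ι) hθ0 hθ1 h0 hLl a t g
    have hS : 0 < ∑ j, groupWeight θ lam a (some j) g :=
      Finset.sum_pos (fun j _ => hpos _) ⟨j, Finset.mem_univ j⟩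
    rw [Fintype.sum_option]
    set Bg := groupWeight θ lam a none g
    set Ag := ∑ j, groupWeight θ lam a (some j) g
    have hle : groupWeight θ lam a (some j) g ≤ Bg + Ag :=
      (Finset.single_le_sum (f := fun j => groupWeight θ lam a (some j) g)
        (fun j _ => (hpos _).le) (Finset.mem_univ j)).trans (by linarith [hpos none])
    set W := ∏ i ∈ I, binWeight L lam none (a i).2 with hW
    set Wj := ∏ i ∈ I, binWeight L lam (some j) (a i).2 with hWj
    have hW0 : 0 < W := Finset.prod_pos fun i _ => binWeight_pos h0 hLl _ _
    have hWj0 : 0 < Wj := Finset.prod_pos fun i _ => binWeight_pos h0 hLl _ _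
    have hBg : Bg ≤ W := by
      have : Bg = (1 - θ) * W := rfl
      rw [this]; nlinarith
    have hAj : groupWeight θ lam a (some j) g = θ / L * Wj := rfl
    set P := ∏ i ∈ I, (if (a i).2 = some j then lam else 1) with hP
    have hP' : P = lam ^ (binSamples a (g, some j)).card := by
      rw [hP, Finset.prod_ite, Finset.prod_const, Finset.prod_const_one, mul_one]
      congr 2
      ext i
      simp [hI, Prod.ext_iff]
    have hP0 : 0 < P := by rw [hP']; positivity
    have hP4 : P ≤ lam ^ 4 := by
      rw [hP']
      exact pow_le_pow_of_le_one h0.le ((le_quarter_of_fin h0 hLl j).trans (by norm_num)) hb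
    have hWW : W ≤ 4 ^ I.card * P * Wj := by
      rw [← Finset.prod_const, hP, hWj, ← Finset.prod_mul_distrib, ← Finset.prod_mul_distrib]
      exact Finset.prod_le_prod (fun i _ => (binWeight_pos h0 hLl _ _).le)
        fun i _ => binWeight_none_le h0 hLl j _
    have hMom : ∏ i ∈ I, momentWeight L lam j (a i).2 = 4 ^ I.card * 4 ^ I.card * (W * P⁻¹) := by
      rw [← mul_pow, ← Finset.prod_const, hW, hP, ← Finset.prod_inv_distrib,
        ← Finset.prod_mul_distrib, ← Finset.prod_mul_distrib]
      refine Finset.prod_congr rfl fun i _ => ?_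
      unfold momentWeight
      split_ifs <;> norm_num
    rw [hMom, add_comm Ag Bg]
    have hZ : 0 < Bg + Ag := add_pos (hpos none) hS
    calc (Bg + Ag) * ((Bg / (Bg + Ag)) ^ 2 * 4 ^ I.card) = Bg ^ 2 / (Bg + Ag) * 4 ^ I.card := by
          field_simp
      _ ≤ W ^ 2 / (θ / L * Wj) * 4 ^ I.card := by
          rw [← hAj]
          have := hpos (some j)
          have h1 := hpos none
          gcongr
      _ ≤ W * (4 ^ I.card * P * Wj) / (θ / L * Wj) * 4 ^ I.card := by
          rw [sq]
          gcongr
      _ = L / θ * (P * P) * (4 ^ I.card * 4 ^ I.card * (W * P⁻¹)) := by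
          field_simp
      _ ≤ L / θ * (lam ^ 4 * lam ^ 4) * (4 ^ I.card * 4 ^ I.card * (W * P⁻¹)) := by
          gcongr
      _ = _ := by ring

end

end Groups

section Mixture

variable {ι G : Type*} [Fintype ι] [DecidableEq ι] [Fintype G] [DecidableEq G] {L : ℕ}

/-- Indicator of the type with a public bin. -/
def typeFlag (t : Option (Fin L)) : ℝ := if t = none then 1 else 0

/-- Indicator of the bins which are light in the type with a public bin. -/
def lightFlag (b : Option (Fin L)) : ℝ := if b = none then 0 else 1

/-- The density of the hard instance with types `t` and orientations `ξ`, relative to the uniform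
measure; `c` is the amplitude of the perturbation. -/
def density (lam : ℝ) (t : G → Option (Fin L)) (ξ : G × Option (Fin L) → Bool) (c : ℝ)
    (z : G × Option (Fin L)) (s : Bool × Bool) : ℝ :=
  binWeight L lam (t z.1) z.2 *
    (1 + boolSign (ξ z) * (c * (typeFlag (t z.1) * (lightFlag z.2 * arcSign s))))

theorem sum_typeWeight_mul_expect_density (θ lam : ℝ) (c : ι → ℝ) (a : ι → G × Option (Fin L))
    (s : ι → Bool × Bool) :
    ∑ t : G → Option (Fin L), (∏ g, typeWeight L θ (t g)) *
        Finset.expect Finset.univ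
          (fun ξ : G × Option (Fin L) → Bool => ∏ i, density lam t ξ (c i) (a i) (s i)) =
      ∏ g, (∑ j, groupWeight θ lam a (some j) g + groupWeight θ lam a none g *
        ∏ b, binRatio ∅ a (fun i => c i * lightFlag (a i).2) s (g, b)) := by
  set x : Option (Fin L) → ι → ℝ := fun t i =>
    c i * (typeFlag t * (lightFlag (a i).2 * arcSign (s i))) with hx
  have h1 : ∀ t : G → Option (Fin L), (∏ g, typeWeight L θ (t g)) *
        Finset.expect Finset.univ
          (fun ξ : G × Option (Fin L) → Bool => ∏ i, density lam t ξ (c i) (a i) (s i)) =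
      ∏ g, (groupWeight θ lam a (t g) g * ∏ b, signAverage (binSamples a (g, b)) (x (t g))) := by
    intro t
    simp only [density, Finset.prod_mul_distrib, groupWeight]
    rw [← Finset.mul_expect, expect_prod_boolSign, Fintype.prod_prod_type,
      ← Finset.prod_fiberwise Finset.univ (fun i => (a i).1), ← mul_assoc]
    congr 1
    · congr 1
      refine Finset.prod_congr rfl fun g _ => Finset.prod_congr rfl fun i hi => ?_
      rw [(Finset.mem_filter.1 hi).2]
    · refine Finset.prod_congr rfl fun g _ => Finset.prod_congr rfl fun b _ =>
        signAverage_congr fun i hi => ?_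
      simp only [hx, (Finset.mem_filter.1 hi).2]
  simp only [h1]
  rw [← Fintype.piFinset_univ, ← Finset.prod_univ_sum (fun _ => Finset.univ) fun g t =>
    groupWeight θ lam a t g * ∏ b, signAverage (binSamples a (g, b)) (x t)]
  refine Finset.prod_congr rfl fun g _ => ?_
  rw [Fintype.sum_option, add_comm]
  congr 1
  · refine Finset.sum_congr rfl fun j _ => ?_
    rw [Finset.prod_eq_one, mul_one]
    exact fun b _ => signAverage_eq_one_of_eq_zero fun i _ => by simp [hx, typeFlag]
  · congr 1
    refine Finset.prod_congr rfl fun b _ => ?_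
    simp only [binRatio, Finset.notMem_empty, if_false]
    exact signAverage_congr fun i _ => by simp [hx, typeFlag, mul_assoc]

/-- The average of `F` over the hard instances, up to normalization. -/
def mixtureSum {U : ℕ} (θ lam : ℝ) (c : ι → ℝ)
    (F : (ι → G × Option (Fin L)) → (ι → Fin U) → (ι → Bool × Bool) → ℝ) : ℝ :=
  ∑ t : G → Option (Fin L), (∏ g, typeWeight L θ (t g)) *
    Finset.expect Finset.univ fun ξ : G × Option (Fin L) → Bool =>
      ∑ a, ∑ u, ∑ s, F a u s * ∏ i, density lam t ξ (c i) (a i) (s i)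

theorem mixtureSum_eq {U : ℕ} (θ lam : ℝ) (c : ι → ℝ)
    (F : (ι → G × Option (Fin L)) → (ι → Fin U) → (ι → Bool × Bool) → ℝ) :
    mixtureSum θ lam c F = ∑ a, ∑ u, ∑ s, F a u s *
      ∏ g, (∑ j, groupWeight θ lam a (some j) g + groupWeight θ lam a none g *
        ∏ b, binRatio ∅ a (fun i => c i * lightFlag (a i).2) s (g, b)) := by
  unfold mixtureSum
  simp only [Finset.expect_sum_comm, ← Finset.mul_expect]
  simp only [Finset.mul_sum]
  rw [Finset.sum_comm]
  refine Finset.sum_congr rfl fun a _ => ?_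
  rw [Finset.sum_comm]
  refine Finset.sum_congr rfl fun u _ => ?_
  rw [Finset.sum_comm]
  refine Finset.sum_congr rfl fun s _ => ?_
  rw [← sum_typeWeight_mul_expect_density, Finset.mul_sum]
  refine Finset.sum_congr rfl fun t _ => ?_
  ring

theorem sum_prod_groupWeight_le {θ lam : ℝ} (hθ0 : 0 < θ) (hθ1 : θ < 1) (h0 : 0 < lam)
    (hLl : L * lam ≤ 1 / 4) (hL : L ≠ 0) :
    ∑ a : ι → G × Option (Fin L), ∏ g, ∑ t, groupWeight θ lam a t g ≤
      (Fintype.card G : ℝ) ^ Fintype.card ι := by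
  have := sum_prod_sum_prod_filter_le (ι := ι) (G := G) (p := fun _ => typeWeight L θ)
    (V := fun _ => binWeight L lam) (S := fun _ => 1)
    (fun _ => typeWeight_nonneg hθ0.le hθ1.le) (fun _ => sum_typeWeight hL θ)
    (fun _ t b => (binWeight_pos h0 hLl t b).le) (fun _ t => (sum_binWeight lam t).le)
  simpa only [Finset.sum_const, Finset.card_univ, nsmul_eq_mul, mul_one, groupWeight] using this

theorem sum_prod_groupWeight_mul_groupVariance_le {θ lam : ℝ} (hθ0 : 0 < θ) (hθ1 : θ < 1)
    (h0 : 0 < lam) (hLl : L * lam ≤ 1 / 4) (hL : L ≠ 0) {c : ι → ℝ} (g₀ : G) :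
    ∑ a : ι → G × Option (Fin L), (∏ g, ∑ t, groupWeight θ lam a t g) *
        groupVariance a (fun i => c i * lightFlag (a i).2)
          (fun g => ∑ j, groupWeight θ lam a (some j) g) (groupWeight θ lam a none) g₀ ≤
      L ^ 2 / θ * lam ^ 8 * ((Fintype.card G : ℝ) + 31) ^ Fintype.card ι := by
  set p : G → Option (Fin L) → ℝ := fun g t =>
    if g = g₀ then (if t = none then 1 else 0) else typeWeight L θ t with hp
  set V : Fin L → G → Option (Fin L) → Option (Fin L) → ℝ := fun j g t =>
    if g = g₀ then momentWeight L lam j else binWeight L lam t with hV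
  have hbound : ∀ a : ι → G × Option (Fin L), (∏ g, ∑ t, groupWeight θ lam a t g) *
        groupVariance a (fun i => c i * lightFlag (a i).2)
          (fun g => ∑ j, groupWeight θ lam a (some j) g) (groupWeight θ lam a none) g₀ ≤
      ∑ j, L / θ * lam ^ 8 * ∏ g, ∑ t, p g t *
        ∏ i ∈ Finset.univ.filter (fun i => (a i).1 = g), V j g t (a i).2 := by
    intro a
    have hne : 0 ≤ ∏ g ∈ Finset.univ.erase g₀, ∑ t, groupWeight θ lam a t g :=
      Finset.prod_nonneg fun g _ => Finset.sum_nonneg fun t _ =>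
        (groupWeight_pos hθ0 hθ1 h0 hLl a t g).le
    have hfac : ∀ j, ∏ g, ∑ t, p g t *
        ∏ i ∈ Finset.univ.filter (fun i => (a i).1 = g), V j g t (a i).2 =
        (∏ i ∈ Finset.univ.filter (fun i => (a i).1 = g₀), momentWeight L lam j (a i).2) *
          ∏ g ∈ Finset.univ.erase g₀, ∑ t, groupWeight θ lam a t g := by
      intro j
      rw [← Finset.mul_prod_erase _ _ (Finset.mem_univ g₀)]
      congr 1
      · simp [hp, hV]
      · refine Finset.prod_congr rfl fun g hg => ?_
        simp [hp, hV, Finset.ne_of_mem_erase hg, groupWeight]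
    simp only [hfac]
    rw [← Finset.mul_prod_erase _ _ (Finset.mem_univ g₀), mul_assoc,
      mul_comm (∏ g ∈ Finset.univ.erase g₀, _), ← mul_assoc]
    simp only [← mul_assoc]
    rw [← Finset.sum_mul]
    exact mul_le_mul_of_nonneg_right (groupVariance_mul_le hθ0 hθ1 h0 hLl hL a
      (fun i hi => by simp [lightFlag, hi]) g₀) hne
  refine (Finset.sum_le_sum fun a _ => hbound a).trans ?_
  rw [Finset.sum_comm]
  have hj : ∀ j : Fin L, ∑ a : ι → G × Option (Fin L), L / θ * lam ^ 8 * ∏ g, ∑ t, p g t *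
        ∏ i ∈ Finset.univ.filter (fun i => (a i).1 = g), V j g t (a i).2 ≤
      L / θ * lam ^ 8 * ((Fintype.card G : ℝ) + 31) ^ Fintype.card ι := by
    intro j
    rw [← Finset.mul_sum]
    refine mul_le_mul_of_nonneg_left ?_ (by positivity)
    refine (sum_prod_sum_prod_filter_le (S := fun g => if g = g₀ then 32 else 1)
      ?_ ?_ ?_ ?_).trans (le_of_eq ?_)
    · intro g t
      simp only [hp]
      split_ifs
      · exact zero_le_one
      · exact le_rfl
      · exact typeWeight_nonneg hθ0.le hθ1.le t
    · intro g
      simp only [hp]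
      split_ifs
      · simp
      · exact sum_typeWeight hL θ
    · intro g t b
      simp only [hV]
      split_ifs
      · exact momentWeight_nonneg h0 hLl j b
      · exact (binWeight_pos h0 hLl t b).le
    · intro g t
      simp only [hV]
      split_ifs
      · exact sum_momentWeight_le h0 hLl j
      · exact (sum_binWeight lam t).le
    · congr 1
      have : ∀ g, (if g = g₀ then (32 : ℝ) else 1) = 1 + if g = g₀ then 31 else 0 := by
        intro g; split_ifs <;> norm_num
      simp only [this, Finset.sum_add_distrib]
      simp
  refine (Finset.sum_le_sum fun j _ => hj j).trans (le_of_eq ?_)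
  simp
  ring

theorem mixtureSum_sub_le {U : ℕ} {θ lam : ℝ} (hθ0 : 0 < θ) (hθ1 : θ < 1)
    (h0 : 0 < lam) (hLl : L * lam ≤ 1 / 4) (hL : L ≠ 0) {c : ι → ℝ} (hc : ∀ i, |c i| ≤ 1)
    {F : (ι → G × Option (Fin L)) → (ι → Fin U) → (ι → Bool × Bool) → ℝ}
    (hF0 : ∀ a u s, 0 ≤ F a u s) (hF1 : ∀ a u s, F a u s ≤ 1)
    (hF : ∀ a u, u.Injective → FlipInvariant a u (F a u))
    (hFu : ∀ a u s, ¬ u.Injective → F a u s = 0) {κ : ℝ} (hκ : 0 < κ) (hκ1 : κ ≤ 1) :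
    mixtureSum θ lam 0 F - mixtureSum θ lam c F ≤
      (U * 4) ^ Fintype.card ι * (κ * (Fintype.card G : ℝ) ^ Fintype.card ι +
        2 / κ * (Fintype.card G * (L ^ 2 / θ * lam ^ 8 *
          ((Fintype.card G : ℝ) + 31) ^ Fintype.card ι))) := by
  set A : (ι → G × Option (Fin L)) → G → ℝ := fun a g => ∑ j, groupWeight θ lam a (some j) g
    with hA
  set B : (ι → G × Option (Fin L)) → G → ℝ := fun a g => groupWeight θ lam a none g with hB
  have hpos : ∀ (a : ι → G × Option (Fin L)) t g, 0 < groupWeight θ lam a t g :=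
    fun a t g => groupWeight_pos hθ0 hθ1 h0 hLl a t g
  have hA0 : ∀ a g, 0 < A a g := fun a g =>
    Finset.sum_pos (fun j _ => hpos _ _ _) ⟨⟨0, Nat.pos_of_ne_zero hL⟩, Finset.mem_univ _⟩
  have hzero : ∀ (a : ι → G × Option (Fin L)) (s : ι → Bool × Bool) g b,
      binRatio ∅ a (fun i => (0 : ι → ℝ) i * lightFlag (a i).2) s (g, b) = 1 := by
    intro a s g b
    simp only [binRatio, Finset.notMem_empty, if_false]
    exact signAverage_eq_one_of_eq_zero fun i _ => by simp
  have hAB : ∀ a g, A a g + B a g = ∑ t, groupWeight θ lam a t g := fun a g => by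
    rw [Fintype.sum_option, add_comm]
  set gv : (ι → G × Option (Fin L)) → G → ℝ := fun a g =>
    groupVariance a (fun i => c i * lightFlag (a i).2) (A a) (B a) g with hgv
  have hgv0 : ∀ a g, 0 ≤ gv a g := by
    intro a g
    simp only [hgv, groupVariance]
    split_ifs
    · exact le_rfl
    · positivity
  rw [mixtureSum_eq, mixtureSum_eq]
  simp only [hzero, Finset.prod_const_one, mul_one, ← Finset.sum_sub_distrib, ← mul_sub]
  have hau : ∀ a (u : ι → Fin U), ∑ s, F a u s * (∏ g, (A a g + B a g) -
      ∏ g, (A a g + B a g * ∏ b, binRatio ∅ a (fun i => c i * lightFlag (a i).2) s (g, b))) ≤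
      4 ^ Fintype.card ι * ((∏ g, (A a g + B a g)) * (κ + 2 / κ * ∑ g, gv a g)) := by
    intro a u
    by_cases hu : u.Injective
    · refine (hF a u hu).sum_mul_sub_le hu (hF0 a u) (hF1 a u) (fun i => ?_) (hA0 a)
        (fun g => (hpos _ _ _).le) hκ hκ1
      unfold lightFlag
      split_ifs
      · simp
      · simpa using hc i
    · simp only [hFu a u _ hu, zero_mul, Finset.sum_const_zero]
      have : 0 ≤ ∏ g, (A a g + B a g) :=
        Finset.prod_nonneg fun g _ => add_nonneg (hA0 a g).le (hpos _ _ _).le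
      have h2 : 0 ≤ ∑ g, gv a g := Finset.sum_nonneg fun g _ => hgv0 a g
      positivity
  refine (Finset.sum_le_sum fun a _ => Finset.sum_le_sum fun u _ => hau a u).trans ?_
  simp only [Finset.sum_const, Finset.card_univ, Fintype.card_fun, Fintype.card_fin, nsmul_eq_mul]
  rw [mul_pow, ← Finset.mul_sum, ← Finset.mul_sum, Nat.cast_pow, ← mul_assoc]
  refine mul_le_mul_of_nonneg_left ?_ (by positivity)
  have hsplit : ∀ a : ι → G × Option (Fin L),
      (∏ g, (A a g + B a g)) * (κ + 2 / κ * ∑ g, gv a g) =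
      κ * (∏ g, (A a g + B a g)) + 2 / κ * ∑ g, (∏ g, (A a g + B a g)) * gv a g := by
    intro a
    rw [← Finset.mul_sum]; ring
  simp only [hsplit, Finset.sum_add_distrib]
  rw [← Finset.mul_sum, ← Finset.mul_sum, Finset.sum_comm]
  refine add_le_add (mul_le_mul_of_nonneg_left ?_ hκ.le)
    (mul_le_mul_of_nonneg_left ?_ (by positivity))
  · simp only [hAB]
    exact sum_prod_groupWeight_le hθ0 hθ1 h0 hLl hL
  · simp only [hAB]
    refine (Finset.sum_le_sum fun g _ =>
      sum_prod_groupWeight_mul_groupVariance_le hθ0 hθ1 h0 hLl hL g).trans (le_of_eq ?_)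
    simp

end Mixture

section Geometry

variable {β : Type*} [Fintype β]

/-- The coordinate of a point at distance `r` from the centre of the bin `z`, on the side given by
`s`. -/
def position (U : ℕ) (z : β) (r : ℕ) (s : Bool) : ℕ :=
  (Fintype.equivFin β z : ℕ) * (2 * U + 1) + if s then U + 1 + r else U - 1 - r

theorem mul_add_lt_mul_add_iff {W A A' o o' : ℕ} (ho : o < W) (ho' : o' < W) :
    A * W + o < A' * W + o' ↔ A < A' ∨ A = A' ∧ o < o' := by
  constructor
  · intro h
    rcases lt_trichotomy A A' with h1 | h1 | h1
    · exact Or.inl h1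
    · subst h1; exact Or.inr ⟨rfl, by omega⟩
    · have : (A' + 1) * W ≤ A * W := Nat.mul_le_mul_right _ h1
      rw [add_mul] at this
      omega
  · rintro (h | ⟨rfl, h⟩)
    · have : (A + 1) * W ≤ A' * W := Nat.mul_le_mul_right _ h
      rw [add_mul] at this
      omega
    · omega

theorem offset_lt {U r : ℕ} (hr : r < U) (s : Bool) :
    (if s then U + 1 + r else U - 1 - r) < 2 * U + 1 := by
  cases s <;> simp <;> omega

theorem position_lt_iff {U : ℕ} {z z' : β} {r r' : ℕ} (hr : r < U) (hr' : r' < U) (hne : r ≠ r')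
    (s s' : Bool) : position U z r s < position U z' r' s' ↔
      Fintype.equivFin β z < Fintype.equivFin β z' ∨
        z = z' ∧ (r < r' ∧ s' = true ∨ r' < r ∧ s = false) := by
  unfold position
  rw [mul_add_lt_mul_add_iff (offset_lt hr s) (offset_lt hr' s'), Fin.lt_def, ← Fin.ext_iff,
    (Fintype.equivFin β).apply_eq_iff_eq]
  refine or_congr Iff.rfl (and_congr Iff.rfl ?_)
  cases s <;> cases s' <;> simp <;> omega

theorem position_ne {U : ℕ} {z z' : β} {r r' : ℕ} (hr : r < U) (hr' : r' < U) (hne : r ≠ r')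
    (s s' : Bool) : position U z r s ≠ position U z' r' s' := by
  intro h
  have h1 := (position_lt_iff (z := z) (z' := z') hr hr' hne s s').not.1 (by omega)
  have h2 := (position_lt_iff (z := z') (z' := z) hr' hr hne.symm s' s).not.1 (by omega)
  push Not at h1 h2
  have hz : z = z' := (Fintype.equivFin β).injective (le_antisymm h2.1 h1.1)
  subst hz
  simp only [position, add_right_inj] at h
  cases s <;> cases s' <;> simp at h <;> omega

theorem position_lt {U : ℕ} (z : β) {r : ℕ} (hr : r < U) (s : Bool) :
    position U z r s < Fintype.card β * (2 * U + 1) := by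
  unfold position
  have h1 := offset_lt hr s
  have h2 : ((Fintype.equivFin β z : ℕ) + 1) * (2 * U + 1) ≤ Fintype.card β * (2 * U + 1) :=
    Nat.mul_le_mul_right _ (Fintype.equivFin β z).2
  rw [add_mul] at h2
  omega

/-- The coordinates of a point of the diamond in the bin `z`. -/
def diamondPoint {U : ℕ} (z : β) (u : Fin U) (s : Bool × Bool) : ℕ × ℕ :=
  (position U z u s.1, Fintype.card β * (2 * U + 1) + position U z u.rev s.2)

/-- The coordinates of a family of points, as a single family. -/
def sampleCoords {ι : Type*} {U : ℕ} (a : ι → β) (u : ι → Fin U) (s : ι → Bool × Bool) :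
    ι ⊕ ι → ℕ :=
  Sum.elim (fun i => (diamondPoint (a i) (u i) (s i)).1)
    fun i => (diamondPoint (a i) (u i) (s i)).2

theorem sampleCoords_lt {ι : Type*} {U : ℕ} (a : ι → β) (u : ι → Fin U) (s : ι → Bool × Bool)
    (i : ι ⊕ ι) : sampleCoords a u s i < 2 * (Fintype.card β * (2 * U + 1)) := by
  rcases i with i | i
  · have := position_lt (a i) (u i).2 (s i).1
    simp only [sampleCoords, diamondPoint, Sum.elim_inl]
    omega
  · have := position_lt (a i) (u i).rev.2 (s i).2
    simp only [sampleCoords, diamondPoint, Sum.elim_inr]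
    omega

theorem sampleCoords_injective {ι : Type*} {U : ℕ} (a : ι → β) {u : ι → Fin U}
    (hu : u.Injective) (s : ι → Bool × Bool) : (sampleCoords a u s).Injective := by
  have hne : ∀ i j, i ≠ j → (u i : ℕ) ≠ u j := fun i j h h' => h (hu (Fin.ext h'))
  have hne' : ∀ i j, i ≠ j → ((u i).rev : ℕ) ≠ (u j).rev := fun i j h h' =>
    h (hu (Fin.rev_injective (Fin.ext h')))
  rintro (i | i) (j | j) h
  · by_contra hij
    exact position_ne (u i).2 (u j).2 (hne i j fun h => hij (by rw [h])) _ _ h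
  · have := position_lt (a i) (u i).2 (s i).1
    simp only [sampleCoords, diamondPoint, Sum.elim_inl, Sum.elim_inr] at h
    omega
  · have := position_lt (a j) (u j).2 (s j).1
    simp only [sampleCoords, diamondPoint, Sum.elim_inl, Sum.elim_inr] at h
    omega
  · by_contra hij
    exact position_ne (u i).rev.2 (u j).rev.2 (hne' i j fun h => hij (by rw [h])) _ _
      (Nat.add_left_cancel h)

theorem sampleCoords_lt_iff {ι : Type*} {U : ℕ} {a : ι → β} {u : ι → Fin U}
    (hu : u.Injective) {s s' : ι → Bool × Bool}
    (h1 : ∀ i j, a i = a j → u i < u j → (s' j).1 = (s j).1)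
    (h2 : ∀ i j, a i = a j → u i < u j → (s' i).2 = (s i).2) (i j : ι ⊕ ι) :
    sampleCoords a u s' i < sampleCoords a u s' j ↔
      sampleCoords a u s i < sampleCoords a u s j := by
  have hne : ∀ i j, i ≠ j → (u i : ℕ) ≠ u j := fun i j h h' => h (hu (Fin.ext h'))
  have hne' : ∀ i j, i ≠ j → ((u i).rev : ℕ) ≠ (u j).rev := fun i j h h' =>
    h (hu (Fin.rev_injective (Fin.ext h')))
  rcases i with i | i <;> rcases j with j | j <;>
    simp only [sampleCoords, diamondPoint, Sum.elim_inl, Sum.elim_inr]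
  · rcases eq_or_ne i j with rfl | hij
    · simp
    · rw [position_lt_iff (u i).2 (u j).2 (hne i j hij),
        position_lt_iff (u i).2 (u j).2 (hne i j hij)]
      refine or_congr Iff.rfl (and_congr_right fun hz => or_congr ?_ ?_)
      · exact and_congr_right fun h => by rw [h1 i j hz h]
      · exact and_congr_right fun h => by rw [h1 j i hz.symm h]
  · have e1 := position_lt (a i) (u i).2 (s i).1
    have e2 := position_lt (a i) (u i).2 (s' i).1
    constructor <;> intro <;> omega
  · have e1 := position_lt (a j) (u j).2 (s j).1
    have e2 := position_lt (a j) (u j).2 (s' j).1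
    constructor <;> intro <;> omega
  · rcases eq_or_ne i j with rfl | hij
    · simp
    · rw [add_lt_add_iff_left, add_lt_add_iff_left,
        position_lt_iff (u i).rev.2 (u j).rev.2 (hne' i j hij),
        position_lt_iff (u i).rev.2 (u j).rev.2 (hne' i j hij)]
      refine or_congr Iff.rfl (and_congr_right fun hz => or_congr ?_ ?_)
      · exact and_congr_right fun h => by rw [h2 j i hz.symm (Fin.rev_lt_rev.1 h)]
      · exact and_congr_right fun h => by rw [h2 i j hz (Fin.rev_lt_rev.1 h)]

theorem flipInvariant_of_orderInvariant {ι : Type*} [DecidableEq ι] {U : ℕ}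
    {f : (ι ⊕ ι → ℕ) → ℝ}
    (hf : ∀ v w : ι ⊕ ι → ℕ, v.Injective → w.Injective →
      (∀ i, v i < 2 * (Fintype.card β * (2 * U + 1))) →
      (∀ i, w i < 2 * (Fintype.card β * (2 * U + 1))) →
      (∀ i j, v i < v j ↔ w i < w j) → f v = f w)
    (a : ι → β) {u : ι → Fin U} (hu : u.Injective) :
    FlipInvariant a u fun s => f (sampleCoords a u s) := by
  have key : ∀ s s' : ι → Bool × Bool,
      (∀ i j, a i = a j → u i < u j → (s' j).1 = (s j).1) →
      (∀ i j, a i = a j → u i < u j → (s' i).2 = (s i).2) →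
      f (sampleCoords a u s') = f (sampleCoords a u s) := fun s s' h1 h2 =>
    hf _ _ (sampleCoords_injective a hu _) (sampleCoords_injective a hu _) (sampleCoords_lt a u _)
      (sampleCoords_lt a u _) (sampleCoords_lt_iff hu h1 h2)
  constructor
  · intro j hj s
    refine key _ _ (fun i l hil hlt => ?_) fun i l hil hlt => ?_
    · rcases eq_or_ne l j with rfl | hl
      · exact absurd (hj i hil (fun h => hlt.ne (by rw [h]))) (not_lt.2 hlt.le)
      · rw [Function.update_of_ne hl]
    · rcases eq_or_ne i j with rfl | hl
      · rw [Function.update_self]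
      · rw [Function.update_of_ne hl]
  · intro j hj s
    refine key _ _ (fun i l hil hlt => ?_) fun i l hil hlt => ?_
    · rcases eq_or_ne l j with rfl | hl
      · rw [Function.update_self]
      · rw [Function.update_of_ne hl]
    · rcases eq_or_ne i j with rfl | hl
      · exact absurd (hj l hil.symm (fun h => hlt.ne (by rw [h]))) (not_lt.2 hlt.le)
      · rw [Function.update_of_ne hl]

end Geometry

section DiscreteMeasure

variable {Ω E : Type*} [Fintype Ω] [MeasurableSpace E] [MeasurableSingletonClass E]

/-- The distribution of `e ω`, where `ω` has distribution `P`. -/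
def discreteMeasure (P : Ω → ℝ) (e : Ω → E) : Measure E :=
  ∑ ω, ENNReal.ofReal (P ω) • Measure.dirac (e ω)

open Classical in
theorem discreteMeasure_apply (P : Ω → ℝ) (e : Ω → E) (R : Set E) :
    discreteMeasure P e R = ∑ ω, if e ω ∈ R then ENNReal.ofReal (P ω) else 0 := by
  simp only [discreteMeasure, Measure.finsetSum_apply, Measure.smul_apply, Measure.dirac_apply,
    smul_eq_mul, Set.indicator_apply, Pi.one_apply, mul_ite, mul_one, mul_zero]

open Classical in
theorem toReal_discreteMeasure_apply {P : Ω → ℝ} (hP : ∀ ω, 0 ≤ P ω) (e : Ω → E) (R : Set E) :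
    (discreteMeasure P e R).toReal = ∑ ω, if e ω ∈ R then P ω else 0 := by
  rw [discreteMeasure_apply, ENNReal.toReal_sum]
  · refine Finset.sum_congr rfl fun ω _ => ?_
    split_ifs
    · exact ENNReal.toReal_ofReal (hP ω)
    · rfl
  · intro ω _
    split_ifs <;> simp

theorem isProbabilityMeasure_discreteMeasure {P : Ω → ℝ} (hP : ∀ ω, 0 ≤ P ω)
    (hP1 : ∑ ω, P ω = 1) (e : Ω → E) : IsProbabilityMeasure (discreteMeasure P e) := by
  classical
  refine ⟨?_⟩
  rw [discreteMeasure_apply]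
  simp only [Set.mem_univ, if_true]
  rw [← ENNReal.ofReal_sum_of_nonneg fun ω _ => hP ω, hP1, ENNReal.ofReal_one]

theorem discreteMeasure_apply_eq_zero (P : Ω → ℝ) (e : Ω → E) {R : Set E}
    (h : ∀ ω, e ω ∉ R) : discreteMeasure P e R = 0 := by
  classical
  rw [discreteMeasure_apply]
  exact Finset.sum_eq_zero fun ω _ => if_neg (h ω)

theorem integral_pi_prod_pi_discreteMeasure {m : ℕ} {P Q : Ω → ℝ} (hP : ∀ ω, 0 ≤ P ω)
    (hP1 : ∑ ω, P ω = 1) (hQ : ∀ ω, 0 ≤ Q ω) (hQ1 : ∑ ω, Q ω = 1) (e : Ω → E)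
    {T : (Fin m → E) × (Fin m → E) → ℝ} (hT : Measurable T) :
    ∫ s, T s ∂((Measure.pi fun _ : Fin m => discreteMeasure P e).prod
        (Measure.pi fun _ : Fin m => discreteMeasure Q e)) =
      ∑ ω : Fin m ⊕ Fin m → Ω, (∏ i, Sum.elim (fun _ => P) (fun _ => Q) i (ω i)) *
        T (fun i => e (ω (Sum.inl i)), fun i => e (ω (Sum.inr i))) := by
  classical
  let _ : MeasurableSpace Ω := ⊤
  have hmap : ∀ P : Ω → ℝ, discreteMeasure P e = (discreteMeasure P id).map e := by
    intro P
    have he : Measurable e := measurable_from_top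
    ext R hR
    rw [Measure.map_apply he hR, discreteMeasure_apply, discreteMeasure_apply]
    rfl
  have he : Measurable e := measurable_from_top
  have hp : ∀ {P : Ω → ℝ}, (∀ ω, 0 ≤ P ω) → ∑ ω, P ω = 1 →
      IsProbabilityMeasure (discreteMeasure P (id : Ω → Ω)) := fun hP hP1 =>
    isProbabilityMeasure_discreteMeasure hP hP1 _
  have := hp hP hP1
  have := hp hQ hQ1
  have : IsProbabilityMeasure ((discreteMeasure P (id : Ω → Ω)).map e) :=
    Measure.isProbabilityMeasure_map he.aemeasurable
  have : IsProbabilityMeasure ((discreteMeasure Q (id : Ω → Ω)).map e) :=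
    Measure.isProbabilityMeasure_map he.aemeasurable
  have hpi : Measurable fun (ω : Fin m → Ω) i => e (ω i) :=
    measurable_pi_lambda _ fun i => he.comp (measurable_pi_apply i)
  rw [hmap P, hmap Q, ← Measure.pi_map_pi (fun _ => he.aemeasurable),
    ← Measure.pi_map_pi (fun _ => he.aemeasurable), Measure.map_prod_map _ _ hpi hpi,
    integral_map (hpi.prodMap hpi).aemeasurable hT.aestronglyMeasurable]
  rw [integral_fintype (Integrable.of_finite)]
  rw [← Equiv.sum_comp (Equiv.sumArrowEquivProdArrow (Fin m) (Fin m) Ω)]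
  refine Finset.sum_congr rfl fun ω _ => ?_
  have hsing : ∀ {P : Ω → ℝ} (ω : Ω), (∀ ω, 0 ≤ P ω) →
      (discreteMeasure P (id : Ω → Ω) {ω}) = ENNReal.ofReal (P ω) := by
    intro P ω hP
    rw [discreteMeasure_apply]
    simp
  rw [smul_eq_mul, Fintype.prod_sum_type]
  congr 1
  rw [Measure.real, ← Set.singleton_prod_singleton]
  have hprod : ∀ {P : Ω → ℝ} (hP : ∀ ω, 0 ≤ P ω) [IsProbabilityMeasure (discreteMeasure P id)]
      (v : Fin m → Ω), ((Measure.pi fun _ => discreteMeasure P id) {v}).toReal = ∏ i, P (v i) := by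
    intro P hP _ v
    rw [Measure.pi_singleton, ENNReal.toReal_prod]
    simp only [hsing _ hP, ENNReal.toReal_ofReal (hP _)]
  rw [Measure.prod_prod, ENNReal.toReal_mul, hprod hP, hprod hQ]
  rfl

end DiscreteMeasure

section AkDistance

theorem isAxisAlignedRectangle_empty {d : ℕ} [NeZero d] :
    IsAxisAlignedRectangle (∅ : Set (Fin d → ℝ)) :=
  ⟨fun _ => ∅, fun _ => Set.ordConnected_empty, (Set.univ_pi_eq_empty (i := 0) rfl).symm⟩

theorem sum_le_akDist {J : Type*} [Fintype J] {d k : ℕ} [NeZero d] (hJ : Fintype.card J ≤ k)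
    (p q : Measure (Fin d → ℝ)) [IsProbabilityMeasure p] [IsProbabilityMeasure q]
    {R : J → Set (Fin d → ℝ)} (hR : ∀ j, IsAxisAlignedRectangle (R j))
    (hd : Pairwise fun i j => Disjoint (R i) (R j)) :
    ∑ j, |(p (R j)).toReal - (q (R j)).toReal| ≤ AkDist k p q := by
  obtain ⟨f⟩ : Nonempty (J ↪ Fin k) := Function.Embedding.nonempty_of_card_le (by simpa)
  set R' : Fin k → Set (Fin d → ℝ) := Function.extend f R fun _ => ∅ with hR'
  have happ : ∀ j, R' (f j) = R j := fun j => f.injective.extend_apply _ _ _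
  have hcases : ∀ i, R' i = ∅ ∨ ∃ j, f j = i := by
    intro i
    by_cases h : ∃ j, f j = i
    · exact Or.inr h
    · exact Or.inl (Function.extend_apply' _ _ _ h)
  have h1 : ∀ i, IsAxisAlignedRectangle (R' i) := by
    intro i
    rcases hcases i with h | ⟨j, rfl⟩
    · rw [h]; exact isAxisAlignedRectangle_empty
    · rw [happ]; exact hR j
  have h2 : Pairwise fun i j => Disjoint (R' i) (R' j) := by
    intro i i' hii
    rcases hcases i with h | ⟨j, rfl⟩
    · rw [h]; exact Set.empty_disjoint _
    rcases hcases i' with h | ⟨j', rfl⟩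
    · rw [h]; exact Set.disjoint_empty _
    · rw [happ, happ]
      exact hd fun h => hii (by rw [h])
  have hbdd : BddAbove (Set.range fun R : {R : Fin k → Set (Fin d → ℝ) //
      (∀ i, IsAxisAlignedRectangle (R i)) ∧ Pairwise fun i j => Disjoint (R i) (R j)} =>
      ∑ i, |(p (R.1 i)).toReal - (q (R.1 i)).toReal|) := by
    refine ⟨∑ _ : Fin k, 1, ?_⟩
    rintro _ ⟨R, rfl⟩
    refine Finset.sum_le_sum fun i _ => ?_
    have e1 : (p (R.1 i)).toReal ≤ 1 := measureReal_le_one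
    have e2 : (q (R.1 i)).toReal ≤ 1 := measureReal_le_one
    rw [abs_le]
    constructor <;> linarith [ENNReal.toReal_nonneg (a := p (R.1 i)),
      ENNReal.toReal_nonneg (a := q (R.1 i))]
  refine le_trans ?_ (le_ciSup hbdd ⟨R', h1, h2⟩)
  calc ∑ j, |(p (R j)).toReal - (q (R j)).toReal| =
      ∑ i ∈ Finset.univ.map f, |(p (R' i)).toReal - (q (R' i)).toReal| := by
        rw [Finset.sum_map]; simp only [happ]
    _ ≤ _ := Finset.sum_le_sum_of_subset_of_nonneg (Finset.subset_univ _)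
        fun _ _ _ => abs_nonneg _

end AkDistance

section HardInstance

variable {G : Type*} [Fintype G] [DecidableEq G] {L : ℕ}

/-- The probabilities of the points of the hard instance. -/
def instanceWeight (U : ℕ) (lam : ℝ) (t : G → Option (Fin L)) (ξ : G × Option (Fin L) → Bool)
    (c : ℝ) (ω : (G × Option (Fin L)) × Fin U × (Bool × Bool)) : ℝ :=
  (Fintype.card G * U * 4 : ℝ)⁻¹ * density lam t ξ c ω.1 ω.2.2

theorem density_nonneg {lam : ℝ} (h0 : 0 < lam) (hLl : L * lam ≤ 1 / 4)
    (t : G → Option (Fin L)) (ξ : G × Option (Fin L) → Bool) {c : ℝ} (hc : |c| ≤ 1)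
    (z : G × Option (Fin L)) (s : Bool × Bool) : 0 ≤ density lam t ξ c z s := by
  refine mul_nonneg (binWeight_pos h0 hLl _ _).le ?_
  have : |boolSign (ξ z) * (c * (typeFlag (t z.1) * (lightFlag z.2 * arcSign s)))| ≤ 1 := by
    rw [abs_mul, abs_mul, abs_mul, abs_mul, abs_boolSign, abs_arcSign, one_mul, mul_one]
    have h1 : |typeFlag (t z.1)| ≤ 1 := by unfold typeFlag; split_ifs <;> simp
    have h2 : |lightFlag z.2| ≤ 1 := by unfold lightFlag; split_ifs <;> simp
    exact mul_le_one₀ hc (by positivity) (mul_le_one₀ h1 (abs_nonneg _) h2)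
  linarith [(abs_le.1 this).1]

theorem sum_density (lam : ℝ) (t : G → Option (Fin L)) (ξ : G × Option (Fin L) → Bool) (c : ℝ)
    (z : G × Option (Fin L)) : ∑ s, density lam t ξ c z s = 4 * binWeight L lam (t z.1) z.2 := by
  simp [density, Fintype.sum_prod_type, arcSign, boolSign]
  ring

theorem instanceWeight_nonneg (U : ℕ) {lam : ℝ} (h0 : 0 < lam) (hLl : L * lam ≤ 1 / 4)
    (t : G → Option (Fin L)) (ξ : G × Option (Fin L) → Bool) {c : ℝ} (hc : |c| ≤ 1)
    (ω : (G × Option (Fin L)) × Fin U × (Bool × Bool)) : 0 ≤ instanceWeight U lam t ξ c ω :=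
  mul_nonneg (by positivity) (density_nonneg h0 hLl t ξ hc _ _)

theorem sum_instanceWeight [Nonempty G] {U : ℕ} (hU : U ≠ 0) (lam : ℝ) (t : G → Option (Fin L))
    (ξ : G × Option (Fin L) → Bool) (c : ℝ) : ∑ ω, instanceWeight U lam t ξ c ω = 1 := by
  unfold instanceWeight
  rw [← Finset.mul_sum, Fintype.sum_prod_type]
  simp only [Fintype.sum_prod_type (α₁ := Fin U), sum_density]
  rw [Fintype.sum_prod_type]
  have hU' : (U : ℝ) ≠ 0 := by exact_mod_cast hU
  have hG : (Fintype.card G : ℝ) ≠ 0 := by exact_mod_cast Fintype.card_ne_zero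
  simp only [Finset.sum_const, Finset.card_univ, Fintype.card_fin, nsmul_eq_mul, ← Finset.mul_sum,
    sum_binWeight]
  field_simp

/-- The location in the plane of a point of the hard instance. -/
def gridPoint {β : Type*} [Fintype β] {U : ℕ} (φ : ℕ → ℕ) (ω : β × Fin U × (Bool × Bool)) :
    Fin 2 → ℝ :=
  ![(φ (diamondPoint ω.1 ω.2.1 ω.2.2).1 : ℝ) + 1, (φ (diamondPoint ω.1 ω.2.1 ω.2.2).2 : ℝ) + 1]

/-- The rectangle containing the north-east arc of the diamond in the bin `z`. -/
def quadrant {β : Type*} [Fintype β] (U : ℕ) (φ : ℕ → ℕ) (z : β) : Set (Fin 2 → ℝ) :=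
  Set.univ.pi ![Set.Icc ((φ (position U z 0 true) : ℝ) + 1) (φ (position U z (U - 1) true) + 1),
    Set.Icc ((φ (Fintype.card β * (2 * U + 1) + position U z 0 true) : ℝ) + 1)
      (φ (Fintype.card β * (2 * U + 1) + position U z (U - 1) true) + 1)]

theorem position_mem_Icc_iff {β : Type*} [Fintype β] {U : ℕ} {z z' : β} {r : ℕ} (hr : r < U)
    (s : Bool) : position U z 0 true ≤ position U z' r s ∧
      position U z' r s ≤ position U z (U - 1) true ↔ z' = z ∧ s = true := by
  have h0 : 0 < U := by omega
  rw [← not_lt, ← not_lt]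
  unfold position
  rw [mul_add_lt_mul_add_iff (offset_lt hr s) (offset_lt h0 true),
    mul_add_lt_mul_add_iff (offset_lt (by omega) true) (offset_lt hr s),
    ← (Fintype.equivFin β).apply_eq_iff_eq, Fin.ext_iff]
  cases s <;> simp <;> omega

variable {φ : ℕ → ℕ}

theorem gridPoint_mem_quadrant_iff {β : Type*} [Fintype β] {U : ℕ}
    (hφ : ∀ i j, i < 2 * (Fintype.card β * (2 * U + 1)) → j < 2 * (Fintype.card β * (2 * U + 1)) →
      (φ i < φ j ↔ i < j)) (z : β) (ω : β × Fin U × (Bool × Bool)) :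
    gridPoint φ ω ∈ quadrant U φ z ↔ ω.1 = z ∧ ω.2.2 = (true, true) := by
  obtain ⟨z', u, s₁, s₂⟩ := ω
  have hU := u.pos
  have hφ' : ∀ i j, i < 2 * (Fintype.card β * (2 * U + 1)) →
      j < 2 * (Fintype.card β * (2 * U + 1)) → (φ i ≤ φ j ↔ i ≤ j) := fun i j hi hj => by
    rw [← not_lt, ← not_lt, hφ j i hj hi]
  have b1 := position_lt z (r := 0) hU true
  have b2 := position_lt z (U := U) (r := U - 1) (by omega) true
  have b3 := position_lt z' u.2 s₁
  have b4 := position_lt z' u.rev.2 s₂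
  simp only [gridPoint, quadrant, Set.mem_univ_pi, Fin.forall_fin_two, Matrix.cons_val_zero,
    Matrix.cons_val_one, Set.mem_Icc, add_le_add_iff_right, Nat.cast_le, diamondPoint]
  set n := Fintype.card β * (2 * U + 1)
  have m1 : ∀ {i}, i < n → i < 2 * n := fun _ => by omega
  have m2 : ∀ {i}, i < n → n + i < 2 * n := fun _ => by omega
  rw [hφ' _ _ (m1 b1) (m1 b3), hφ' _ _ (m1 b3) (m1 b2), hφ' _ _ (m2 b1) (m2 b4),
    hφ' _ _ (m2 b4) (m2 b2), add_le_add_iff_left, add_le_add_iff_left,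
    position_mem_Icc_iff u.2, position_mem_Icc_iff u.rev.2, Prod.mk.injEq]
  tauto

theorem disjoint_quadrant {β : Type*} [Fintype β] {U : ℕ} (hU : U ≠ 0)
    (hφ : ∀ i j, i < 2 * (Fintype.card β * (2 * U + 1)) → j < 2 * (Fintype.card β * (2 * U + 1)) →
      (φ i < φ j ↔ i < j)) {z z' : β} (h : z ≠ z') :
    Disjoint (quadrant U φ z) (quadrant U φ z') := by
  rw [Set.disjoint_left]
  intro x hx hx'
  apply h
  have hφ' : ∀ i j, i < 2 * (Fintype.card β * (2 * U + 1)) →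
      j < 2 * (Fintype.card β * (2 * U + 1)) → (φ i ≤ φ j ↔ i ≤ j) := fun i j hi hj => by
    rw [← not_lt, ← not_lt, hφ j i hj hi]
  have key : ∀ {z z' : β}, x ∈ quadrant U φ z → x ∈ quadrant U φ z' →
      Fintype.equivFin β z ≤ Fintype.equivFin β z' := by
    intro z z' hz hz'
    have h1 : (φ (position U z 0 true) : ℝ) + 1 ≤ x 0 := (hz 0 trivial).1
    have h2 : x 0 ≤ φ (position U z' (U - 1) true) + 1 := (hz' 0 trivial).2
    have h3 : φ (position U z 0 true) ≤ φ (position U z' (U - 1) true) := by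
      have := h1.trans h2
      exact_mod_cast (add_le_add_iff_right (1 : ℝ)).1 this
    have b1 := position_lt z (r := 0) (U := U) (by omega) true
    have b2 := position_lt z' (r := U - 1) (U := U) (by omega) true
    rw [hφ' _ _ (by omega) (by omega), ← not_lt] at h3
    unfold position at h3
    rw [mul_add_lt_mul_add_iff (offset_lt (by omega) true) (offset_lt (by omega) true)] at h3
    rw [Fin.le_def]
    omega
  exact (Fintype.equivFin β).injective (le_antisymm (key hx hx') (key hx' hx))

theorem isAxisAlignedRectangle_quadrant {β : Type*} [Fintype β] (U : ℕ) (φ : ℕ → ℕ) (z : β) :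
    IsAxisAlignedRectangle (quadrant U φ z) := by
  refine ⟨_, ?_, rfl⟩
  simp only [Fin.forall_fin_two, Matrix.cons_val_zero, Matrix.cons_val_one]
  exact ⟨Set.ordConnected_Icc, Set.ordConnected_Icc⟩

theorem le_akDist_discreteMeasure [Nonempty G] {k U : ℕ} (hU : U ≠ 0)
    (hφ : ∀ i j, i < 2 * (Fintype.card (G × Option (Fin L)) * (2 * U + 1)) →
      j < 2 * (Fintype.card (G × Option (Fin L)) * (2 * U + 1)) → (φ i < φ j ↔ i < j))
    (hk : Fintype.card G * L ≤ k) {lam : ℝ} (h0 : 0 < lam) (hLl : L * lam ≤ 1 / 4)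
    (t : G → Option (Fin L)) (ξ : G × Option (Fin L) → Bool) :
    L * lam * (Finset.univ.filter fun g => t g = none).card / (2 * Fintype.card G) ≤
      AkDist k (discreteMeasure (instanceWeight U lam t ξ 1) (gridPoint φ))
        (discreteMeasure (instanceWeight U lam t ξ (-1)) (gridPoint φ)) := by
  classical
  have hp := isProbabilityMeasure_discreteMeasure
    (instanceWeight_nonneg U h0 hLl t ξ (c := 1) (by simp)) (sum_instanceWeight hU lam t ξ 1)
    (gridPoint φ)
  have hq := isProbabilityMeasure_discreteMeasure
    (instanceWeight_nonneg U h0 hLl t ξ (c := -1) (by simp)) (sum_instanceWeight hU lam t ξ (-1))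
    (gridPoint φ)
  refine le_trans (le_of_eq ?_) (sum_le_akDist (J := G × Fin L) (by simpa using hk) _ _
    (R := fun z => quadrant U φ (z.1, some z.2)) (fun z => isAxisAlignedRectangle_quadrant _ _ _)
    fun z z' h => disjoint_quadrant hU hφ fun h' => h ?_)
  · have hz : ∀ c, |c| ≤ 1 → ∀ z : G × Fin L,
        (discreteMeasure (instanceWeight U lam t ξ c) (gridPoint φ)
          (quadrant U φ (z.1, some z.2))).toReal =
        (Fintype.card G * 4 : ℝ)⁻¹ * density lam t ξ c (z.1, some z.2) (true, true) := by
      intro c hc z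
      rw [toReal_discreteMeasure_apply (instanceWeight_nonneg U h0 hLl t ξ hc)]
      simp only [gridPoint_mem_quadrant_iff hφ, ite_and]
      rw [Fintype.sum_prod_type]
      simp only [Finset.sum_ite_irrel, Finset.sum_const_zero, Finset.sum_ite_eq', Finset.mem_univ,
        if_true, Fintype.sum_prod_type (α₁ := Fin U), instanceWeight, Finset.sum_const,
        Finset.card_univ, Fintype.card_fin, nsmul_eq_mul]
      have hU' : (U : ℝ) ≠ 0 := by exact_mod_cast hU
      have hG : (Fintype.card G : ℝ) ≠ 0 := by exact_mod_cast Fintype.card_ne_zero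
      field_simp
    simp only [hz 1 (by simp), hz (-1) (by simp), ← mul_sub]
    set f : G → ℝ := fun g => if t g = none then lam / (2 * Fintype.card G) else 0 with hf
    have hab : ∀ z : G × Fin L, |(Fintype.card G * 4 : ℝ)⁻¹ *
        (density lam t ξ 1 (z.1, some z.2) (true, true) -
          density lam t ξ (-1) (z.1, some z.2) (true, true))| = f z.1 := by
      intro z
      simp only [hf]
      split_ifs with h
      · have : density lam t ξ 1 (z.1, some z.2) (true, true) -
            density lam t ξ (-1) (z.1, some z.2) (true, true) =
            2 * lam * boolSign (ξ (z.1, some z.2)) := by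
          simp only [density, h, binWeight, typeFlag, lightFlag, arcSign]
          cases ξ (z.1, some z.2) <;> simp [boolSign] <;> ring
        rw [this, abs_mul, abs_mul, abs_boolSign, abs_of_nonneg (by positivity),
          abs_of_nonneg (by positivity)]
        have hG : (Fintype.card G : ℝ) ≠ 0 := by exact_mod_cast Fintype.card_ne_zero
        field_simp
        norm_num
      · simp [density, typeFlag, h]
    simp only [hab]
    rw [Fintype.sum_prod_type]
    simp only [Finset.sum_const, Finset.card_univ, Fintype.card_fin, nsmul_eq_mul]
    rw [← Finset.mul_sum, hf, ← Finset.sum_filter, Finset.sum_const, nsmul_eq_mul]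
    ring
  · simpa [Prod.ext_iff] using h'

theorem gridSupported_discreteMeasure {β : Type*} [Fintype β] {U N : ℕ}
    (hφ : ∀ i < 2 * (Fintype.card β * (2 * U + 1)), φ i < N)
    (P : β × Fin U × (Bool × Bool) → ℝ) :
    GridSupported N (discreteMeasure P (gridPoint φ)) := by
  refine discreteMeasure_apply_eq_zero _ _ fun ω => ?_
  obtain ⟨z, u, s₁, s₂⟩ := ω
  have b1 := position_lt z u.2 s₁
  have b2 := position_lt z u.rev.2 s₂
  simp only [Set.mem_compl_iff, not_not, Set.mem_ofPred_eq, Fin.forall_fin_two]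
  exact ⟨⟨⟨_, hφ (position U z u s₁) (by omega)⟩, by simp [gridPoint, diamondPoint]⟩,
    ⟨⟨_, hφ (Fintype.card β * (2 * U + 1) + position U z u.rev s₂) (by omega)⟩,
      by simp [gridPoint, diamondPoint]⟩⟩

end HardInstance

section Averages

variable {ι G : Type*} [Fintype ι] [DecidableEq ι] [Fintype G] [DecidableEq G] {L U : ℕ}

/-- The expectation of `F` for samples from a hard instance, up to normalization. -/
def instanceSum (lam : ℝ) (t : G → Option (Fin L)) (ξ : G × Option (Fin L) → Bool) (c : ι → ℝ)
    (F : (ι → G × Option (Fin L)) → (ι → Fin U) → (ι → Bool × Bool) → ℝ) : ℝ :=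
  ∑ a, ∑ u, ∑ s, F a u s * ∏ i, density lam t ξ (c i) (a i) (s i)

theorem instanceSum_mono {lam : ℝ} (h0 : 0 < lam) (hLl : L * lam ≤ 1 / 4)
    (t : G → Option (Fin L)) (ξ : G × Option (Fin L) → Bool) {c : ι → ℝ} (hc : ∀ i, |c i| ≤ 1)
    {F F' : (ι → G × Option (Fin L)) → (ι → Fin U) → (ι → Bool × Bool) → ℝ}
    (h : ∀ a u s, F a u s ≤ F' a u s) :
    instanceSum lam t ξ c F ≤ instanceSum lam t ξ c F' :=
  Finset.sum_le_sum fun a _ => Finset.sum_le_sum fun u _ => Finset.sum_le_sum fun s _ =>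
    mul_le_mul_of_nonneg_right (h a u s)
      (Finset.prod_nonneg fun i _ => density_nonneg h0 hLl t ξ (hc i) _ _)

theorem instanceSum_sub (lam : ℝ) (t : G → Option (Fin L)) (ξ : G × Option (Fin L) → Bool)
    (c : ι → ℝ) (F F' : (ι → G × Option (Fin L)) → (ι → Fin U) → (ι → Bool × Bool) → ℝ) :
    instanceSum lam t ξ c (fun a u s => F a u s - F' a u s) =
      instanceSum lam t ξ c F - instanceSum lam t ξ c F' := by
  simp only [instanceSum, sub_mul, Finset.sum_sub_distrib]

theorem instanceSum_of_radius (lam : ℝ) (t : G → Option (Fin L))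
    (ξ : G × Option (Fin L) → Bool) (c : ι → ℝ) (P : (ι → Fin U) → ℝ) :
    instanceSum lam t ξ c (fun _ u _ => P u) =
      (Fintype.card G * 4) ^ Fintype.card ι * ∑ u, P u := by
  have hs : ∀ a : ι → G × Option (Fin L), ∑ s : ι → Bool × Bool,
      ∏ i, density lam t ξ (c i) (a i) (s i) =
      ∏ i, 4 * binWeight L lam (t (a i).1) (a i).2 := by
    intro a
    rw [← Fintype.piFinset_univ, ← Finset.prod_univ_sum (fun _ => Finset.univ) fun i v =>
      density lam t ξ (c i) (a i) v]
    simp only [sum_density]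
  have ha : ∑ a : ι → G × Option (Fin L), ∏ i, 4 * binWeight L lam (t (a i).1) (a i).2 =
      (Fintype.card G * 4 : ℝ) ^ Fintype.card ι := by
    rw [← Fintype.piFinset_univ, ← Finset.prod_univ_sum (fun _ => Finset.univ)
      fun (_ : ι) (z : G × Option (Fin L)) => 4 * binWeight L lam (t z.1) z.2]
    simp only [Fintype.sum_prod_type, ← Finset.mul_sum, sum_binWeight]
    simp [mul_comm]
  unfold instanceSum
  simp only [← Finset.mul_sum, hs, ← Finset.sum_mul]
  rw [ha, mul_comm]

theorem sum_prod_typeWeight (hL : L ≠ 0) (θ : ℝ) :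
    ∑ t : G → Option (Fin L), ∏ g, typeWeight L θ (t g) = 1 := by
  rw [← Fintype.piFinset_univ, ← Finset.prod_univ_sum (fun _ => Finset.univ)
    fun (_ : G) t => typeWeight L θ t]
  simp only [sum_typeWeight hL, Finset.prod_const_one]

theorem sum_prod_typeWeight_mul_card (hL : L ≠ 0) (θ : ℝ) :
    ∑ t : G → Option (Fin L), (∏ g, typeWeight L θ (t g)) *
      (Finset.univ.filter fun g => t g ≠ none).card = Fintype.card G * θ := by
  have h1 : ∀ g₀ : G, ∑ t : G → Option (Fin L), (∏ g, typeWeight L θ (t g)) *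
      (if t g₀ ≠ none then 1 else 0) = θ := by
    intro g₀
    have h2 : ∀ t : G → Option (Fin L), (∏ g, typeWeight L θ (t g)) *
        (if t g₀ ≠ none then 1 else 0) =
        ∏ g, typeWeight L θ (t g) * if g = g₀ then (if t g ≠ none then 1 else 0) else 1 := by
      intro t
      rw [Finset.prod_mul_distrib, Finset.prod_ite_eq' Finset.univ g₀]
      simp
    simp only [h2]
    rw [← Fintype.piFinset_univ, ← Finset.prod_univ_sum (fun _ => Finset.univ)
      fun (g : G) t => typeWeight L θ t * if g = g₀ then (if t ≠ none then 1 else 0) else 1,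
      ← Finset.mul_prod_erase _ _ (Finset.mem_univ g₀), Finset.prod_eq_one fun g hg => ?_]
    · have : (L : ℝ) ≠ 0 := by exact_mod_cast hL
      simp [Fintype.sum_option, typeWeight]
      field_simp
    · simp only [Finset.ne_of_mem_erase hg, if_false, mul_one, sum_typeWeight hL]
  have h3 : ∀ t : G → Option (Fin L), (((Finset.univ.filter fun g => t g ≠ none).card : ℕ) : ℝ) =
      ∑ g, if t g ≠ none then 1 else 0 := by
    intro t
    rw [Finset.card_filter]
    push_cast
    rfl
  simp only [h3, Finset.mul_sum]
  rw [Finset.sum_comm]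
  simp only [h1]
  simp

theorem mixtureSum_le {θ lam : ℝ} (hθ0 : 0 ≤ θ) (hθ1 : θ ≤ 1) {c : ι → ℝ}
    {F : (ι → G × Option (Fin L)) → (ι → Fin U) → (ι → Bool × Bool) → ℝ}
    {X : (G → Option (Fin L)) → ℝ} (h : ∀ t ξ, instanceSum lam t ξ c F ≤ X t) :
    mixtureSum θ lam c F ≤ ∑ t, (∏ g, typeWeight L θ (t g)) * X t := by
  refine Finset.sum_le_sum fun t _ => mul_le_mul_of_nonneg_left ?_
    (Finset.prod_nonneg fun g _ => typeWeight_nonneg hθ0 hθ1 _)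
  exact (Finset.expect_le_expect fun ξ _ => h t ξ).trans_eq (Fintype.expect_const _)

theorem le_mixtureSum {θ lam : ℝ} (hθ0 : 0 ≤ θ) (hθ1 : θ ≤ 1) {c : ι → ℝ}
    {F : (ι → G × Option (Fin L)) → (ι → Fin U) → (ι → Bool × Bool) → ℝ}
    {X : (G → Option (Fin L)) → ℝ} (h : ∀ t ξ, X t ≤ instanceSum lam t ξ c F) :
    ∑ t, (∏ g, typeWeight L θ (t g)) * X t ≤ mixtureSum θ lam c F := by
  refine Finset.sum_le_sum fun t _ => mul_le_mul_of_nonneg_left ?_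
    (Finset.prod_nonneg fun g _ => typeWeight_nonneg hθ0 hθ1 _)
  exact (Fintype.expect_const _).symm.trans_le (Finset.expect_le_expect fun ξ _ => h t ξ)

open Classical in
theorem sum_not_injective_le {δ : ℝ} (hU : U ≠ 0)
    (h : (Fintype.card ι : ℝ) ^ 2 ≤ δ * U) :
    ∑ u : ι → Fin U, (if u.Injective then 0 else 1 : ℝ) ≤ δ * U ^ Fintype.card ι := by
  set n := Fintype.card ι with hn
  have hU0 : (0 : ℝ) < U := by exact_mod_cast Nat.pos_of_ne_zero hU
  have hcard : (Finset.univ.filter fun u : ι → Fin U => u.Injective).card =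
      U.descFactorial n := by
    rw [← Fintype.card_subtype, Fintype.card_congr (Equiv.subtypeInjectiveEquivEmbedding ι (Fin U)),
      Fintype.card_embedding_eq, Fintype.card_fin]
  have hsum : ∑ u : ι → Fin U, (if u.Injective then 0 else 1 : ℝ) =
      U ^ n - U.descFactorial n := by
    rw [← hcard, Finset.card_filter]
    push_cast
    have : (U : ℝ) ^ n = ∑ _ : ι → Fin U, 1 := by simp [hn]
    rw [this, ← Finset.sum_sub_distrib]
    refine Finset.sum_congr rfl fun u _ => ?_
    split_ifs <;> norm_num
  rw [hsum]
  rcases lt_or_ge U n with hUn | hUn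
  · have : 1 ≤ δ := by
      have h1 : (U : ℝ) < n := by exact_mod_cast hUn
      have h2 : (1 : ℝ) ≤ n := by exact_mod_cast (by omega : 1 ≤ n)
      by_contra hδ
      nlinarith
    have h3 : (0 : ℝ) < (U : ℝ) ^ n := by positivity
    have h4 : (0 : ℝ) ≤ U.descFactorial n := by positivity
    nlinarith
  · have h1 : ((U - n : ℕ) : ℝ) ^ n ≤ U.descFactorial n := by
      have h2 : (U - n) ^ n ≤ (U + 1 - n) ^ n := Nat.pow_le_pow_left (by omega) n
      exact_mod_cast h2.trans (Nat.pow_sub_le_descFactorial U n)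
    have h2 : 1 + (n : ℝ) * (-(n / U)) ≤ (1 + -(n / U)) ^ n := by
      refine one_add_mul_le_pow ?_ n
      have : (n : ℝ) / U ≤ 1 := (div_le_one hU0).2 (by exact_mod_cast hUn)
      linarith
    have h3 : ((U - n : ℕ) : ℝ) ^ n = U ^ n * (1 + -(n / U)) ^ n := by
      rw [← mul_pow, Nat.cast_sub hUn]
      congr 1
      field_simp
      ring
    have h4 : (n : ℝ) * (n / U) ≤ δ := by
      rw [← mul_div_assoc, div_le_iff₀ hU0, ← sq]; exact h
    have h5 : (0 : ℝ) < (U : ℝ) ^ n := by positivity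
    have h6 : (1 - δ) * (U : ℝ) ^ n ≤ U ^ n * (1 + -(n / U)) ^ n := by
      rw [mul_comm]
      exact mul_le_mul_of_nonneg_left (by linarith) h5.le
    linarith

/-- No test of the perturbed instances against the unperturbed ones is close to a test which
depends only on the relative order of the samples. -/
theorem false_of_instanceSum_bounds [Nonempty G] {lam : ℝ} (h0 : 0 < lam) (hLl : L * lam ≤ 1 / 4)
    (hL : L ≠ 0) (hU : U ≠ 0) (hUn : (Fintype.card ι : ℝ) ^ 2 ≤ 1 / 100 * U)
    (hX : Fintype.card G * (L ^ 2 / (1 / 100 : ℝ) * lam ^ 8 *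
      ((Fintype.card G : ℝ) + 31) ^ Fintype.card ι) ≤
        (Fintype.card G : ℝ) ^ Fintype.card ι / 1000)
    {c : ι → ℝ} (hc : ∀ i, |c i| ≤ 1)
    {F F' : (ι → G × Option (Fin L)) → (ι → Fin U) → (ι → Bool × Bool) → ℝ}
    (hF1 : ∀ a u s, F a u s ≤ 1) (hF'0 : ∀ a u s, 0 ≤ F' a u s)
    (hF'F : ∀ a u s, F' a u s ≤ F a u s) (hFF' : ∀ a u s, F a u s ≤ F' a u s + 1 / 100)
    (hflip : ∀ a u, u.Injective → FlipInvariant a u (F' a u))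
    (hyes : ∀ t ξ, 2 / 3 * (Fintype.card G * U * 4 : ℝ) ^ Fintype.card ι ≤
      instanceSum lam t ξ 0 F)
    (hno : ∀ t ξ, Fintype.card G ≤ 2 * (Finset.univ.filter fun g => t g = none).card →
      instanceSum lam t ξ c F ≤ 1 / 3 * (Fintype.card G * U * 4 : ℝ) ^ Fintype.card ι) :
    False := by
  classical
  set n := Fintype.card ι
  set C : ℝ := (Fintype.card G * U * 4 : ℝ) ^ n with hC
  have hG : (0 : ℝ) < Fintype.card G := by exact_mod_cast Fintype.card_pos
  have hU0 : (0 : ℝ) < U := by exact_mod_cast Nat.pos_of_ne_zero hU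
  have hC0 : 0 < C := by positivity
  have hCe : ∀ x : ℝ, (Fintype.card G * 4 : ℝ) ^ n * (x * U ^ n) = x * C := fun x => by
    rw [hC, mul_pow, mul_pow, mul_pow]; ring
  set H : (ι → G × Option (Fin L)) → (ι → Fin U) → (ι → Bool × Bool) → ℝ := fun a u s =>
    if u.Injective then F' a u s else 0 with hH
  have hone : ∀ t ξ (c : ι → ℝ), instanceSum lam t ξ c
      (fun (_ : ι → G × Option (Fin L)) (_ : ι → Fin U) _ => (1 : ℝ)) = C := by
    intro t ξ c
    have h1 : ∑ _ : ι → Fin U, (1 : ℝ) = 1 * U ^ n := by simp [n]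
    rw [instanceSum_of_radius lam t ξ c fun _ => 1, h1, hCe, one_mul]
  have hlow : ∀ t ξ, (2 / 3 - 1 / 50) * C ≤ instanceSum lam t ξ 0 H := by
    intro t ξ
    have h1 : instanceSum lam t ξ 0 (fun a u s => (F a u s - 1 / 100) -
        (if u.Injective then 0 else 1)) ≤ instanceSum lam t ξ (0 : ι → ℝ) H := by
      refine instanceSum_mono h0 hLl t ξ (by simp) fun a u s => ?_
      simp only [hH]
      split_ifs
      · linarith [hFF' a u s]
      · linarith [hF1 a u s]
    rw [instanceSum_sub, instanceSum_sub, instanceSum_of_radius lam t ξ 0 fun _ => 1 / 100,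
      instanceSum_of_radius lam t ξ 0 fun u => if u.Injective then 0 else 1] at h1
    have h2 := mul_le_mul_of_nonneg_left (sum_not_injective_le (ι := ι) hU hUn)
      (by positivity : (0 : ℝ) ≤ (Fintype.card G * 4 : ℝ) ^ n)
    rw [hCe] at h2
    have h3 : (Fintype.card G * 4 : ℝ) ^ n * ∑ _ : ι → Fin U, (1 / 100 : ℝ) = 1 / 100 * C := by
      rw [← hCe]; simp [n, mul_comm]
    rw [h3] at h1
    linarith [hyes t ξ]
  have hhigh : ∀ t ξ, instanceSum lam t ξ c H ≤ C * (1 / 3 + 2 / Fintype.card G *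
      (Finset.univ.filter fun g => t g ≠ none).card) := by
    intro t ξ
    have hHF : ∀ a u s, H a u s ≤ F a u s := fun a u s => by
      simp only [hH]
      split_ifs
      · exact hF'F a u s
      · exact (hF'0 a u s).trans (hF'F a u s)
    have hcard := Finset.card_filter_add_card_filter_not (s := Finset.univ) fun g => t g = none
    rw [Finset.card_univ] at hcard
    refine (instanceSum_mono h0 hLl t ξ hc hHF).trans ?_
    rcases le_or_gt (Fintype.card G) (2 * (Finset.univ.filter fun g => t g = none).card) with h | h
    · refine (hno t ξ h).trans ?_
      rw [mul_comm]
      refine mul_le_mul_of_nonneg_left ?_ hC0.le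
      have : (0 : ℝ) ≤ 2 / Fintype.card G * (Finset.univ.filter fun g => t g ≠ none).card := by
        positivity
      linarith
    · refine (instanceSum_mono h0 hLl t ξ hc hF1).trans ?_
      rw [hone]
      refine le_mul_of_one_le_right hC0.le ?_
      have h1 : (Fintype.card G : ℝ) ≤ 2 * (Finset.univ.filter fun g => t g ≠ none).card := by
        exact_mod_cast (by omega : Fintype.card G ≤
          2 * (Finset.univ.filter fun g => ¬ t g = none).card)
      have h2 : 1 ≤ 2 / (Fintype.card G : ℝ) * (Finset.univ.filter fun g => t g ≠ none).card := by
        rw [div_mul_eq_mul_div, le_div_iff₀ hG]; linarith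
      linarith
  have hA := le_mixtureSum (θ := 1 / 100) (by norm_num) (by norm_num) hlow
  have hB := mixtureSum_le (θ := 1 / 100) (by norm_num) (by norm_num) hhigh
  rw [← Finset.sum_mul, sum_prod_typeWeight hL, one_mul] at hA
  have hB' : ∑ t : G → Option (Fin L), (∏ g, typeWeight L (1 / 100) (t g)) *
      (C * (1 / 3 + 2 / Fintype.card G * (Finset.univ.filter fun g => t g ≠ none).card)) =
      C * (1 / 3 * ∑ t : G → Option (Fin L), (∏ g, typeWeight L (1 / 100) (t g)) +
        2 / Fintype.card G * ∑ t : G → Option (Fin L), (∏ g, typeWeight L (1 / 100) (t g)) *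
          (Finset.univ.filter fun g => t g ≠ none).card) := by
    rw [Finset.mul_sum, Finset.mul_sum, ← Finset.sum_add_distrib, Finset.mul_sum]
    exact Finset.sum_congr rfl fun t _ => by ring
  rw [hB', sum_prod_typeWeight hL, sum_prod_typeWeight_mul_card hL,
    show 2 / (Fintype.card G : ℝ) * (Fintype.card G * (1 / 100)) = 1 / 50 by
      field_simp; norm_num] at hB
  have hD := mixtureSum_sub_le (θ := 1 / 100) (κ := 1 / 10) (F := H) (by norm_num) (by norm_num)
    h0 hLl hL hc
    (fun a u s => by
      simp only [hH]
      split_ifs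
      exacts [hF'0 a u s, le_rfl])
    (fun a u s => by
      simp only [hH]
      split_ifs
      exacts [(hF'F a u s).trans (hF1 a u s), zero_le_one])
    (fun a u hu => by simpa only [hH, hu, if_true] using hflip a u hu)
    (fun a u s hu => by simp only [hH, hu, if_false]) (by norm_num) (by norm_num)
  have hE : (U * 4 : ℝ) ^ n * (1 / 10 * (Fintype.card G : ℝ) ^ n + 2 / (1 / 10) *
      ((Fintype.card G : ℝ) ^ n / 1000)) = 3 / 25 * C := by
    rw [hC, mul_assoc (Fintype.card G : ℝ), mul_pow]; ring
  have hE' := mul_le_mul_of_nonneg_left (add_le_add_right (mul_le_mul_of_nonneg_left hX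
    (by norm_num : (0 : ℝ) ≤ 2 / (1 / 10))) (1 / 10 * (Fintype.card G : ℝ) ^ n))
    (by positivity : (0 : ℝ) ≤ (U * 4 : ℝ) ^ n)
  rw [hE] at hE'
  linarith

end Averages

section Parameters

theorem add_thirtyOne_pow_le (m : ℕ) :
    ((m + 1 : ℕ) + 31 : ℝ) ^ (m + m) ≤ 3 ^ 62 * ((m + 1 : ℕ) : ℝ) ^ (m + m) := by
  have hK : (0 : ℝ) < (m + 1 : ℕ) := by positivity
  have h1 : ((m + 1 : ℕ) + 31 : ℝ) ≤ Real.exp (31 / (m + 1 : ℕ)) * (m + 1 : ℕ) := by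
    have := mul_le_mul_of_nonneg_right (Real.add_one_le_exp (31 / ((m + 1 : ℕ) : ℝ))) hK.le
    rwa [add_mul, div_mul_cancel₀ _ hK.ne', one_mul, add_comm] at this
  have h2 : Real.exp (31 / (m + 1 : ℕ)) ^ (m + m) ≤ 3 ^ 62 := by
    rw [← Real.exp_nat_mul]
    have h3 : ((m + m : ℕ) : ℝ) * (31 / (m + 1 : ℕ)) ≤ (62 : ℕ) * 1 := by
      rw [← mul_div_assoc, div_le_iff₀ hK]
      push_cast
      linarith
    refine (Real.exp_le_exp.2 h3).trans ?_
    rw [Real.exp_nat_mul]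
    exact pow_le_pow_left₀ (Real.exp_pos _).le (by linarith [Real.exp_one_lt_d9]) _
  calc ((m + 1 : ℕ) + 31 : ℝ) ^ (m + m)
      ≤ (Real.exp (31 / (m + 1 : ℕ)) * (m + 1 : ℕ)) ^ (m + m) :=
        pow_le_pow_left₀ (by positivity) h1 _
    _ ≤ _ := by
        rw [mul_pow]
        exact mul_le_mul_of_nonneg_right h2 (by positivity)

variable {k m : ℕ} {ε : ℝ}

theorem add_one_le_of_lt_min (hk : 2 ≤ k)
    (hm : (m : ℝ) < 1 / 2 * min ((k : ℝ) ^ ((6 : ℝ) / 7) / ε ^ ((8 : ℝ) / 7)) (k : ℝ)) :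
    m + 1 ≤ k := by
  have h : (2 * m : ℝ) < k := by
    linarith [min_le_right ((k : ℝ) ^ ((6 : ℝ) / 7) / ε ^ ((8 : ℝ) / 7)) (k : ℝ)]
  have : 2 * m < k := by exact_mod_cast h
  omega

theorem add_one_pow_mul_pow_le (hk : 2 ≤ k) (h0 : 0 < ε) (h1 : ε < 1)
    (hm : (m : ℝ) < 1 / 2 * min ((k : ℝ) ^ ((6 : ℝ) / 7) / ε ^ ((8 : ℝ) / 7)) (k : ℝ)) :
    ((m + 1 : ℕ) : ℝ) ^ 7 * ε ^ 8 ≤ (k : ℝ) ^ 6 := by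
  have hk0 : (0 : ℝ) ≤ k := by positivity
  have he : (0 : ℝ) < ε ^ ((8 : ℝ) / 7) := Real.rpow_pos_of_pos h0 _
  have key : ((m + 1 : ℕ) : ℝ) * ε ^ ((8 : ℝ) / 7) ≤ (k : ℝ) ^ ((6 : ℝ) / 7) := by
    rcases Nat.eq_zero_or_pos m with rfl | hm0
    · have hk1 : (1 : ℝ) ≤ k := by exact_mod_cast (by omega : 1 ≤ k)
      have h3 := Real.rpow_le_one h0.le h1.le (by norm_num : (0 : ℝ) ≤ 8 / 7)
      have h4 := Real.one_le_rpow hk1 (by norm_num : (0 : ℝ) ≤ 6 / 7)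
      simpa using h3.trans h4
    · have h2 : (2 * m : ℝ) < (k : ℝ) ^ ((6 : ℝ) / 7) / ε ^ ((8 : ℝ) / 7) := by
        linarith [min_le_left ((k : ℝ) ^ ((6 : ℝ) / 7) / ε ^ ((8 : ℝ) / 7)) (k : ℝ)]
      have h3 : ((m + 1 : ℕ) : ℝ) ≤ 2 * m := by exact_mod_cast (by omega : m + 1 ≤ 2 * m)
      exact (le_div_iff₀ he).1 (h3.trans h2.le)
  have h7 := pow_le_pow_left₀ (by positivity) key 7
  rw [mul_pow, ← Real.rpow_mul_natCast h0.le, ← Real.rpow_mul_natCast hk0,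
    show (8 : ℝ) / 7 * (7 : ℕ) = (8 : ℕ) by norm_num,
    show (6 : ℝ) / 7 * (7 : ℕ) = (6 : ℕ) by norm_num, Real.rpow_natCast, Real.rpow_natCast] at h7
  exact h7

theorem parameter_bound (hk : 2 ≤ k) (h0 : 0 < ε) (h1 : ε < 1)
    (hm : (m : ℝ) < 1 / 2 * min ((k : ℝ) ^ ((6 : ℝ) / 7) / ε ^ ((8 : ℝ) / 7)) (k : ℝ)) :
    ((m + 1 : ℕ) : ℝ) * (((k / (m + 1) : ℕ) : ℝ) ^ 2 / (1 / 100 : ℝ) *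
      ((1 / 2) ^ 20 * ε / ((k / (m + 1) : ℕ) : ℝ)) ^ 8 * (((m + 1 : ℕ) : ℝ) + 31) ^ (m + m)) ≤
        ((m + 1 : ℕ) : ℝ) ^ (m + m) / 1000 := by
  have hKk := add_one_le_of_lt_min hk hm
  have hpow := add_one_pow_mul_pow_le hk h0 h1 hm
  have hexp := add_thirtyOne_pow_le m
  have hk2 : k ≤ 2 * ((m + 1) * (k / (m + 1))) := by
    have h2 : 1 ≤ k / (m + 1) := (Nat.one_le_div_iff (by omega)).2 hKk
    have h3 := Nat.div_add_mod k (m + 1)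
    have h4 := Nat.mod_lt k (by omega : m + 1 > 0)
    have h5 := Nat.mul_le_mul_left (m + 1) h2
    omega
  have hL : 0 < k / (m + 1) := Nat.div_pos hKk (by omega)
  generalize k / (m + 1) = L at *
  generalize hK : m + 1 = K at *
  have hK0 : (0 : ℝ) < K := by exact_mod_cast (by omega : 0 < K)
  have hL0 : (0 : ℝ) < L := by exact_mod_cast hL
  have hk2' : (k : ℝ) ≤ 2 * (K * L) := by exact_mod_cast hk2
  have h2 : (K : ℝ) * ε ^ 8 ≤ 64 * L ^ 6 := by
    have h3 := hpow.trans (pow_le_pow_left₀ (by positivity) hk2' 6)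
    have h4 : (0 : ℝ) < (K : ℝ) ^ 6 := by positivity
    refine le_of_mul_le_mul_left ?_ h4
    calc (K : ℝ) ^ 6 * (K * ε ^ 8) = K ^ 7 * ε ^ 8 := by ring
      _ ≤ _ := h3
      _ = _ := by ring
  have h3 : (K : ℝ) * ε ^ 8 / L ^ 6 ≤ 64 := (div_le_iff₀ (by positivity)).2 h2
  calc (K : ℝ) * ((L : ℝ) ^ 2 / (1 / 100 : ℝ) * ((1 / 2) ^ 20 * ε / L) ^ 8 *
        ((K : ℝ) + 31) ^ (m + m))
      = 100 * (1 / 2) ^ 160 * (K * ε ^ 8 / L ^ 6) * ((K : ℝ) + 31) ^ (m + m) := by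
        field_simp
    _ ≤ 100 * (1 / 2) ^ 160 * 64 * (3 ^ 62 * (K : ℝ) ^ (m + m)) := by gcongr
    _ = 100 * (1 / 2) ^ 160 * 64 * 3 ^ 62 * (K : ℝ) ^ (m + m) := by ring
    _ ≤ 1 / 1000 * (K : ℝ) ^ (m + m) := by
        refine mul_le_mul_of_nonneg_right ?_ (by positivity)
        norm_num
    _ = _ := by ring

end Parameters

section Main

/-- The pair of sample tuples with the given coordinates. -/
def sampleTuple {m : ℕ} (w : (Fin m ⊕ Fin m) ⊕ (Fin m ⊕ Fin m) → ℕ) :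
    (Fin m → (Fin 2 → ℝ)) × (Fin m → (Fin 2 → ℝ)) :=
  (fun i => ![(w (.inl (.inl i)) : ℝ) + 1, (w (.inr (.inl i)) : ℝ) + 1],
    fun i => ![(w (.inl (.inr i)) : ℝ) + 1, (w (.inr (.inr i)) : ℝ) + 1])

variable {G : Type*} [Fintype G] [DecidableEq G] {L : ℕ}

theorem integral_instance_eq [Nonempty G] {m U : ℕ} (hU : U ≠ 0) {lam : ℝ} (h0 : 0 < lam)
    (hLl : L * lam ≤ 1 / 4) (t : G → Option (Fin L)) (ξ : G × Option (Fin L) → Bool) {c₁ c₂ : ℝ}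
    (hc₁ : |c₁| ≤ 1) (hc₂ : |c₂| ≤ 1) (φ : ℕ → ℕ)
    {T : (Fin m → (Fin 2 → ℝ)) × (Fin m → (Fin 2 → ℝ)) → ℝ} (hT : Measurable T) :
    (Fintype.card G * U * 4 : ℝ) ^ Fintype.card (Fin m ⊕ Fin m) *
      ∫ s, T s ∂((Measure.pi fun _ : Fin m =>
          discreteMeasure (instanceWeight U lam t ξ c₁) (gridPoint φ)).prod
        (Measure.pi fun _ : Fin m =>
          discreteMeasure (instanceWeight U lam t ξ c₂) (gridPoint φ))) =
      instanceSum lam t ξ (Sum.elim (fun _ => c₁) fun _ => c₂)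
        (fun a (u : Fin m ⊕ Fin m → Fin U) s => T (sampleTuple (φ ∘ sampleCoords a u s))) := by
  have hG : (Fintype.card G : ℝ) ≠ 0 := by exact_mod_cast Fintype.card_ne_zero
  have hU' : (U : ℝ) ≠ 0 := by exact_mod_cast hU
  rw [integral_pi_prod_pi_discreteMeasure (instanceWeight_nonneg U h0 hLl t ξ hc₁)
    (sum_instanceWeight hU lam t ξ c₁) (instanceWeight_nonneg U h0 hLl t ξ hc₂)
    (sum_instanceWeight hU lam t ξ c₂) _ hT, Finset.mul_sum,
    ← (Equiv.arrowProdEquivProdArrow (Fin m ⊕ Fin m) (fun _ => G × Option (Fin L))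
      (fun _ => Fin U × (Bool × Bool))).symm.sum_comp, Fintype.sum_prod_type]
  unfold instanceSum
  refine Finset.sum_congr rfl fun a _ => ?_
  rw [← (Equiv.arrowProdEquivProdArrow (Fin m ⊕ Fin m) (fun _ => Fin U)
      (fun _ => Bool × Bool)).symm.sum_comp, Fintype.sum_prod_type]
  refine Finset.sum_congr rfl fun u _ => Finset.sum_congr rfl fun s _ => ?_
  have hprod : ∏ i : Fin m ⊕ Fin m, Sum.elim (fun _ => instanceWeight U lam t ξ c₁)
      (fun _ => instanceWeight U lam t ξ c₂) i (a i, u i, s i) =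
      ((Fintype.card G * U * 4 : ℝ)⁻¹) ^ Fintype.card (Fin m ⊕ Fin m) *
        ∏ i, density lam t ξ ((Sum.elim (fun _ => c₁) fun _ => c₂ : Fin m ⊕ Fin m → ℝ) i)
          (a i) (s i) := by
    rw [← Finset.card_univ (α := Fin m ⊕ Fin m), ← Finset.prod_const, ← Finset.prod_mul_distrib]
    refine Finset.prod_congr rfl fun i _ => ?_
    rcases i with i | i <;> rfl
  have hC : (Fintype.card G * U * 4 : ℝ) ^ Fintype.card (Fin m ⊕ Fin m) *
      ((Fintype.card G * U * 4 : ℝ)⁻¹) ^ Fintype.card (Fin m ⊕ Fin m) = 1 := by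
    rw [← mul_pow, mul_inv_cancel₀ (by positivity), one_pow]
  simp only [Equiv.arrowProdEquivProdArrow, Equiv.coe_fn_symm_mk]
  rw [hprod, ← mul_assoc, ← mul_assoc, hC, one_mul, mul_comm]
  rfl

end Main

end

/-- **Sample complexity lower bound for `A_k` closeness testing in two dimensions.**
There are universal constants `c, c' > 0` such that, for every `k ≥ 2`, `ε ∈ (0,1)` and
every sample size `m < c·min(k^(6/7)/ε^(8/7), k)`, there is a (sufficiently large) domain
size `N` such that every (randomized, measurable) test `T`, given by its
acceptance-probability function on pairs of `m`-tuples of samples, fails on some pair of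
distributions on `[N] × [N]`: either `p = q` and `T` rejects with probability `> 1/3`,
or `‖p − q‖_{A_k} ≥ c'·ε` and `T` accepts with probability `> 1/3`. -/
theorem ak_closeness_testing_lower_bound :
    ∃ c c' : ℝ, 0 < c ∧ 0 < c' ∧
      ∀ k : ℕ, 2 ≤ k → ∀ ε : ℝ, 0 < ε → ε < 1 → ∀ m : ℕ,
        (m : ℝ) < c * min ((k : ℝ) ^ ((6 : ℝ) / 7) / ε ^ ((8 : ℝ) / 7)) (k : ℝ) →
        ∃ N : ℕ, 0 < N ∧
          ∀ T : (Fin m → (Fin 2 → ℝ)) × (Fin m → (Fin 2 → ℝ)) → ℝ,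
            Measurable T → (∀ s, T s ∈ Set.Icc (0 : ℝ) 1) →
            ∃ p q : Measure (Fin 2 → ℝ),
              IsProbabilityMeasure p ∧ IsProbabilityMeasure q ∧
              GridSupported N p ∧ GridSupported N q ∧
              ((p = q ∧
                  (1 : ℝ) / 3 < ∫ s, (1 - T s) ∂((Measure.pi fun _ : Fin m => p).prod
                      (Measure.pi fun _ : Fin m => q))) ∨
               (c' * ε ≤ AkDist k p q ∧
                  (1 : ℝ) / 3 < ∫ s, T s ∂((Measure.pi fun _ : Fin m => p).prod
                      (Measure.pi fun _ : Fin m => q)))) := by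
  refine ⟨1 / 2, (1 / 2) ^ 22, by norm_num, by norm_num, fun k hk ε hε0 hε1 m hm => ?_⟩
  have hKk := add_one_le_of_lt_min hk hm
  have hX := parameter_bound hk hε0 hε1 hm
  have hKL : (m + 1) * (k / (m + 1)) ≤ k := Nat.mul_div_le k (m + 1)
  have hL : k / (m + 1) ≠ 0 := (Nat.div_pos hKk (by omega)).ne'
  generalize k / (m + 1) = L at *
  have hL0 : (0 : ℝ) < L := by exact_mod_cast Nat.pos_of_ne_zero hL
  set lam : ℝ := (1 / 2) ^ 20 * ε / L with hlam
  have h0 : 0 < lam := by positivity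
  have hLlam : L * lam = (1 / 2) ^ 20 * ε := by rw [hlam]; field_simp
  have hLl : L * lam ≤ 1 / 4 := by rw [hLlam]; linarith
  obtain ⟨U, hU, hUn⟩ : ∃ U : ℕ, U ≠ 0 ∧
      (Fintype.card (Fin m ⊕ Fin m) : ℝ) ^ 2 ≤ 1 / 100 * U := by
    refine ⟨100 * Fintype.card (Fin m ⊕ Fin m) ^ 2 + 1, by omega, ?_⟩
    push_cast
    linarith
  have hn : Fintype.card (Fin m ⊕ Fin m) = m + m := by simp
  obtain ⟨N, hN⟩ := exists_orderInvariant_embedding ((Fin m ⊕ Fin m) ⊕ (Fin m ⊕ Fin m)) (Fin 101)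
    (2 * (Fintype.card (Fin (m + 1) × Option (Fin L)) * (2 * U + 1)))
  refine ⟨N + 1, N.succ_pos, fun T hT hT01 => ?_⟩
  by_contra! hfail
  obtain ⟨φ, hφ, hφN, hinv⟩ := hN fun w => ⟨⌊100 * T (sampleTuple w)⌋₊, by
    rw [Nat.floor_lt' (by norm_num)]
    push_cast
    linarith [(hT01 (sampleTuple w)).2]⟩
  have hφN' : ∀ i < 2 * (Fintype.card (Fin (m + 1) × Option (Fin L)) * (2 * U + 1)),
      φ i < N + 1 := fun i hi => (hφN i hi).trans N.lt_succ_self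
  have hC0 : (0 : ℝ) < (Fintype.card (Fin (m + 1)) * U * 4 : ℝ) ^ Fintype.card (Fin m ⊕ Fin m) := by
    have : (0 : ℝ) < U := by exact_mod_cast Nat.pos_of_ne_zero hU
    have : (0 : ℝ) < Fintype.card (Fin (m + 1)) := by exact_mod_cast Fintype.card_pos
    positivity
  have hprob : ∀ (t : Fin (m + 1) → Option (Fin L)) ξ (c : ℝ), |c| ≤ 1 → IsProbabilityMeasure
      (discreteMeasure (instanceWeight U lam t ξ c) (gridPoint φ)) := fun t ξ c hc =>
    isProbabilityMeasure_discreteMeasure (instanceWeight_nonneg U h0 hLl t ξ hc)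
      (sum_instanceWeight hU lam t ξ c) _
  have hfloor : ∀ w : (Fin m ⊕ Fin m) ⊕ (Fin m ⊕ Fin m) → ℕ,
      (⌊100 * T (sampleTuple w)⌋₊ : ℝ) / 100 ≤ T (sampleTuple w) ∧
      T (sampleTuple w) ≤ (⌊100 * T (sampleTuple w)⌋₊ : ℝ) / 100 + 1 / 100 := by
    intro w
    have h1 := Nat.floor_le (a := 100 * T (sampleTuple w)) (by linarith [(hT01 (sampleTuple w)).1])
    have h2 := Nat.lt_floor_add_one (100 * T (sampleTuple w))
    constructor <;> linarith
  refine false_of_instanceSum_bounds (G := Fin (m + 1)) (ι := Fin m ⊕ Fin m) h0 hLl hL hU hUn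
    (by rw [hn, Fintype.card_fin]; exact hX)
    (c := Sum.elim (fun _ => 1) fun _ => -1) (by rintro (i | i) <;> simp)
    (F := fun a u s => T (sampleTuple (φ ∘ sampleCoords a u s)))
    (F' := fun a u s => (⌊100 * T (sampleTuple (φ ∘ sampleCoords a u s))⌋₊ : ℝ) / 100)
    (fun a u s => (hT01 _).2) (fun a u s => by positivity) (fun a u s => (hfloor _).1)
    (fun a u s => (hfloor _).2)
    (fun a u hu => flipInvariant_of_orderInvariant
      (f := fun w => (⌊100 * T (sampleTuple (φ ∘ w))⌋₊ : ℝ) / 100) (fun v w hv hw hvM hwM h => by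
        have := congrArg Fin.val (hinv v w hv hw hvM hwM h)
        simp only at this
        simp only [this]) a hu)
    (fun t ξ => ?_) fun t ξ hcard => ?_
  · have hp := hprob t ξ 0 (by simp)
    have h1 := (hfail _ _ hp hp (gridSupported_discreteMeasure hφN' _)
      (gridSupported_discreteMeasure hφN' _)).1 rfl
    have hTint : Integrable T ((Measure.pi fun _ : Fin m =>
          discreteMeasure (instanceWeight U lam t ξ 0) (gridPoint φ)).prod
        (Measure.pi fun _ : Fin m =>
          discreteMeasure (instanceWeight U lam t ξ 0) (gridPoint φ))) :=
      Integrable.of_bound hT.aestronglyMeasurable 1 (Filter.Eventually.of_forall fun s => by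
        rw [Real.norm_eq_abs, abs_of_nonneg (hT01 s).1]; exact (hT01 s).2)
    rw [integral_sub (integrable_const _) hTint] at h1
    simp only [integral_const, probReal_univ, smul_eq_mul, mul_one] at h1
    have h2 := integral_instance_eq hU h0 hLl t ξ (c₁ := 0) (c₂ := 0) (by simp) (by simp) φ hT
    have hz : (Sum.elim (fun _ => 0) fun _ => 0 : Fin m ⊕ Fin m → ℝ) = 0 := by
      ext (i | i) <;> rfl
    rw [hz] at h2
    rw [← h2, mul_comm]
    exact mul_le_mul_of_nonneg_left (by linarith) hC0.le
  · have hp := hprob t ξ 1 (by simp)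
    have hq := hprob t ξ (-1) (by simp)
    have hdist : (1 / 2) ^ 22 * ε ≤
        AkDist k (discreteMeasure (instanceWeight U lam t ξ 1) (gridPoint φ))
          (discreteMeasure (instanceWeight U lam t ξ (-1)) (gridPoint φ)) := by
      refine le_trans ?_ (le_akDist_discreteMeasure hU hφ (by rwa [Fintype.card_fin]) h0 hLl t ξ)
      have hK : (0 : ℝ) < Fintype.card (Fin (m + 1)) := by exact_mod_cast Fintype.card_pos
      have hcard' : (Fintype.card (Fin (m + 1)) : ℝ) ≤
          2 * (Finset.univ.filter fun g => t g = none).card := by exact_mod_cast hcard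
      rw [hLlam, le_div_iff₀ (by positivity)]
      have := mul_le_mul_of_nonneg_left hcard' (by positivity : 0 ≤ (1 / 2) ^ 21 * ε)
      linarith
    have h1 := (hfail _ _ hp hq (gridSupported_discreteMeasure hφN' _)
      (gridSupported_discreteMeasure hφN' _)).2 hdist
    rw [← integral_instance_eq hU h0 hLl t ξ (by simp) (by simp) φ hT, mul_comm]
    exact mul_le_mul_of_nonneg_right h1 hC0.le
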